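/- Let N ≥ 2 and 1 < p_− < p_+ < ∞. Then there exist a constant ϰ₀ > 0 depending only on p_−, p_+ and N, a continuous exponent p : ℝ^N → [p_−, p_+] with |p(x) − p(y)| ≤ ϰ₀·(log(1/|x−y|))^{−1}·log log(1/|x−y|) for 0 < |x−y| ≤ e^{−e}, a boundary datum u^∂ ∈ C^∞(ℝ^N), and t₀ > 0, such that for every t ≥ t₀ there exists a function w : Ω → ℝ with weak gradient g ∈ L¹(Ω;ℝ^N), with w − t·u^∂ bounded and compactly supported in Ω and ∫_Ω |g(x)|^{p(x)} dx < ∞, satisfying ∫_Ω |g(x)|^{p(x)} dx < inf{ ∫_Ω |t·∇u^∂(x) + ∇φ(x)|^{p(x)} dx : φ ∈ C_c^∞(Ω) }. In particular, for the Dirichlet problem with boundary datum t·u^∂ the minimum of the variable-exponent energy over the Sobolev class of competitors is strictly smaller than the infimum over smooth competitors with the same boundary values (W-minimizer ≠ H-minimizer, 0-form case). -/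

import Mathlib

open MeasureTheory Real Filter
open scoped Topology ENNReal

noncomputable section

/-- `ℝ^N` with the Euclidean structure. -/
abbrev Euc (N : ℕ) := EuclideanSpace ℝ (Fin N)

/-- The open ball of radius `√N` centered at the origin. -/
def Omg (N : ℕ) : Set (Euc N) := Metric.ball 0 (Real.sqrt N)

/-- A smooth function compactly supported in `Ω`. -/
def IsTestFun (N : ℕ) (φ : Euc N → ℝ) : Prop :=
  ContDiff ℝ (⊤ : ℕ∞) φ ∧ HasCompactSupport φ ∧ tsupport φ ⊆ Omg N

/-- `w` is locally integrable on `Ω` and has weak gradient `g ∈ L¹(Ω;ℝ^N)`. -/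
def HasWeakGradOn (N : ℕ) (w : Euc N → ℝ) (g : Euc N → Euc N) : Prop :=
  LocallyIntegrableOn w (Omg N) ∧ IntegrableOn g (Omg N) ∧
  ∀ φ : Euc N → ℝ, IsTestFun N φ → ∀ i : Fin N,
    (∫ x in Omg N, w x * fderiv ℝ φ x (EuclideanSpace.single i 1))
      = - ∫ x in Omg N, g x i * φ x

/-- A Cantor staircase `F` of Hölder exponent `D`, with the distance `d` to the set on which it
grows. -/
structure Staircase (D : ℝ) where
  F : ℝ → ℝ
  d : ℝ → ℝ
  K : ℝ
  mono : Monotone F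
  eq_zero : ∀ x ≤ -(1 / 4), F x = 0
  eq_one : ∀ x, 1 / 4 ≤ x → F x = 1
  holder : ∀ x y, |F x - F y| ≤ K * |x - y| ^ D
  d_nonneg : ∀ x, 0 ≤ d x
  d_lip : ∀ x y, |d x - d y| ≤ |x - y|
  le_d : ∀ x, |x| - 1 / 4 ≤ d x
  d_le : ∀ x, d x ≤ |x| + 1 / 4
  eq_of_lt : ∀ x y, |y - x| < d x → F y = F x
  volume_le : ∀ r, 0 < r → r ≤ 1 → volume {x | d x < r} ≤ ENNReal.ofReal (K * r ^ (1 - D))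

/-- The similarity operator whose fixed point is the Cantor staircase. -/
def stairStep (l : ℝ) (f : ℝ → ℝ) (x : ℝ) : ℝ :=
  (f ((x + (1 - l) / 4) / l) + f ((x - (1 - l) / 4) / l)) / 2

/-- The approximations of the Cantor staircase. -/
def stairSeq (l : ℝ) : ℕ → ℝ → ℝ
  | 0 => fun x => if 1 / 4 ≤ x then 1 else 0
  | k + 1 => stairStep l (stairSeq l k)

lemma stairStep_mono {l : ℝ} (f g : ℝ → ℝ) (h : ∀ x, f x ≤ g x) (x : ℝ) :
    stairStep l f x ≤ stairStep l g x := by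
  unfold stairStep
  linarith [h ((x + (1 - l) / 4) / l), h ((x - (1 - l) / 4) / l)]

lemma stairSeq_monotone {l : ℝ} (hl : 0 < l) (k : ℕ) : Monotone (stairSeq l k) := by
  induction k with
  | zero =>
    intro x y hxy
    simp only [stairSeq]
    split_ifs <;> linarith
  | succ k ih =>
    intro x y hxy
    simp only [stairSeq, stairStep]
    have h1 : stairSeq l k ((x + (1 - l) / 4) / l) ≤ stairSeq l k ((y + (1 - l) / 4) / l) :=
      ih (by gcongr)
    have h2 : stairSeq l k ((x - (1 - l) / 4) / l) ≤ stairSeq l k ((y - (1 - l) / 4) / l) :=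
      ih (by gcongr)
    linarith

lemma stairSeq_eq_zero {l : ℝ} (hl : 0 < l) (hl2 : l < 1) (k : ℕ) :
    ∀ x ≤ -(1 / 4), stairSeq l k x = 0 := by
  induction k with
  | zero =>
    intro x hx
    simp only [stairSeq]
    rw [if_neg (by linarith)]
  | succ k ih =>
    intro x hx
    simp only [stairSeq, stairStep]
    rw [ih, ih]
    · simp
    · rw [div_le_iff₀ hl]; linarith
    · rw [div_le_iff₀ hl]; linarith

lemma stairSeq_eq_one {l : ℝ} (hl : 0 < l) (hl2 : l < 1) (k : ℕ) :
    ∀ x, 1 / 4 ≤ x → stairSeq l k x = 1 := by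
  induction k with
  | zero =>
    intro x hx
    simp only [stairSeq]
    rw [if_pos hx]
  | succ k ih =>
    intro x hx
    simp only [stairSeq, stairStep]
    rw [ih, ih]
    · norm_num
    · rw [le_div_iff₀ hl]; linarith
    · rw [le_div_iff₀ hl]; linarith

lemma stairSeq_nonneg (l : ℝ) (k : ℕ) : ∀ x, 0 ≤ stairSeq l k x := by
  induction k with
  | zero => intro x; simp only [stairSeq]; split_ifs <;> norm_num
  | succ k ih =>
    intro x
    simp only [stairSeq, stairStep]
    linarith [ih ((x + (1 - l) / 4) / l), ih ((x - (1 - l) / 4) / l)]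

lemma stairSeq_le_one (l : ℝ) (k : ℕ) : ∀ x, stairSeq l k x ≤ 1 := by
  induction k with
  | zero => intro x; simp only [stairSeq]; split_ifs <;> norm_num
  | succ k ih =>
    intro x
    simp only [stairSeq, stairStep]
    linarith [ih ((x + (1 - l) / 4) / l), ih ((x - (1 - l) / 4) / l)]

lemma stairSeq_le_succ {l : ℝ} (hl : 0 < l) (hl2 : l < 1) (k : ℕ) :
    ∀ x, stairSeq l k x ≤ stairSeq l (k + 1) x := by
  induction k with
  | zero =>
    intro x
    by_cases hx : 1 / 4 ≤ x
    · rw [stairSeq_eq_one hl hl2 _ x hx, stairSeq_eq_one hl hl2 _ x hx]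
    · have : stairSeq l 0 x = 0 := by simp only [stairSeq]; rw [if_neg hx]
      rw [this]; exact stairSeq_nonneg _ _ _
  | succ k ih =>
    intro x
    exact stairStep_mono _ _ ih x

lemma exists_stair {l : ℝ} (hl : 0 < l) (hl2 : l < 1) :
    ∃ F : ℝ → ℝ, Monotone F ∧ (∀ x ≤ -(1 / 4), F x = 0) ∧ (∀ x, 1 / 4 ≤ x → F x = 1) ∧
      ∀ x, F x = (F ((x + (1 - l) / 4) / l) + F ((x - (1 - l) / 4) / l)) / 2 := by
  have hlim : ∀ x, Tendsto (fun k => stairSeq l k x) atTop (𝓝 (⨆ k, stairSeq l k x)) := fun x =>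
    tendsto_atTop_ciSup (monotone_nat_of_le_succ fun k => stairSeq_le_succ hl hl2 k x)
      ⟨1, by rintro _ ⟨k, rfl⟩; exact stairSeq_le_one l k x⟩
  refine ⟨fun x => ⨆ k, stairSeq l k x, ?_, ?_, ?_, ?_⟩
  · intro x y hxy
    exact le_of_tendsto_of_tendsto' (hlim x) (hlim y) fun k => stairSeq_monotone hl k hxy
  · intro x hx
    simp [stairSeq_eq_zero hl hl2 _ x hx]
  · intro x hx
    simp [stairSeq_eq_one hl hl2 _ x hx]
  · intro x
    refine tendsto_nhds_unique ((tendsto_add_atTop_iff_nat 1).2 (hlim x)) ?_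
    exact ((hlim _).add (hlim _)).div_const 2

section

variable {l : ℝ} {F : ℝ → ℝ}

lemma stair_mem (hmono : Monotone F) (h0 : ∀ x ≤ -(1 / 4), F x = 0)
    (h1 : ∀ x, 1 / 4 ≤ x → F x = 1) (x : ℝ) : 0 ≤ F x ∧ F x ≤ 1 := by
  constructor
  · rw [← h0 (min x (-(1 / 4))) (min_le_right _ _)]
    exact hmono (min_le_left _ _)
  · rw [← h1 (max x (1 / 4)) (le_max_right _ _)]
    exact hmono (le_max_left _ _)

lemma stair_osc (hl : 0 < l) (hl2 : l < 1 / 2) (hmono : Monotone F)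
    (h0 : ∀ x ≤ -(1 / 4), F x = 0) (h1 : ∀ x, 1 / 4 ≤ x → F x = 1)
    (hF : ∀ x, F x = (F ((x + (1 - l) / 4) / l) + F ((x - (1 - l) / 4) / l)) / 2) (k : ℕ) :
    ∀ x y, x ≤ y → y - x ≤ (1 / 2 - l) * l ^ k → F y - F x ≤ (1 / 2) ^ k := by
  induction k with
  | zero =>
    intro x y _ _
    have := (stair_mem hmono h0 h1 x).1
    have := (stair_mem hmono h0 h1 y).2
    simp; linarith
  | succ k ih =>
    intro x y hxy hd
    have hd' : ∀ c, (y + c) / l - (x + c) / l ≤ (1 / 2 - l) * l ^ k := by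
      intro c
      rw [← sub_div, div_le_iff₀ hl]
      rw [pow_succ] at hd
      linarith
    have hd1 : y - x ≤ 1 / 2 - l := hd.trans (mul_le_of_le_one_right (by linarith)
      (pow_le_one₀ hl.le (by linarith)))
    have hle : ∀ c, (x + c) / l ≤ (y + c) / l := fun c => by gcongr
    have e1 := ih _ _ (hle ((1 - l) / 4)) (hd' _)
    have e2 := ih _ _ (hle (-((1 - l) / 4))) (hd' _)
    simp only [← sub_eq_add_neg] at e2
    rw [hF x, hF y, pow_succ]
    by_cases hx : x ≤ -(1 / 4 - l / 2)
    · have z1 : F ((x - (1 - l) / 4) / l) = 0 := h0 _ (by rw [div_le_iff₀ hl]; linarith)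
      have z2 : F ((y - (1 - l) / 4) / l) = 0 := h0 _ (by rw [div_le_iff₀ hl]; linarith)
      rw [z1, z2]
      linarith
    · push Not at hx
      have z1 : F ((x + (1 - l) / 4) / l) = 1 := h1 _ (by rw [le_div_iff₀ hl]; linarith)
      have z2 : F ((y + (1 - l) / 4) / l) = 1 := h1 _ (by rw [le_div_iff₀ hl]; linarith)
      rw [z1, z2]
      linarith

/-- Bounds along a geometric sequence of scales give bounds at all scales. -/
lemma exists_scale (hl : 0 < l) (hl1 : l < 1) {r : ℝ} (hr : 0 < r) (hr1 : r ≤ 1) :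
    ∃ k : ℕ, r ≤ l ^ k ∧ l ^ (k + 1) < r := by
  obtain ⟨k, h1, h2⟩ := exists_nat_pow_near_of_lt_one hr hr1 hl hl1
  exact ⟨k, h2, h1⟩

lemma stair_volume (hl : 0 < l) (hl2 : l < 1 / 2)
    (h0 : ∀ x ≤ -(1 / 4), F x = 0) (h1 : ∀ x, 1 / 4 ≤ x → F x = 1)
    (hF : ∀ x, F x = (F ((x + (1 - l) / 4) / l) + F ((x - (1 - l) / 4) / l)) / 2) (k : ℕ) :
    volume {x | F (x - l ^ k) ≠ F (x + l ^ k)} ≤ ENNReal.ofReal (4 * (2 * l) ^ k) := by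
  induction k with
  | zero =>
    calc volume {x | F (x - l ^ 0) ≠ F (x + l ^ 0)} ≤ volume (Set.Icc (-2 : ℝ) 2) := by
          refine measure_mono fun x hx => ?_
          simp only [pow_zero, Set.mem_ofPred_eq, ne_eq] at hx
          by_contra hx'
          simp only [Set.mem_Icc, not_and_or, not_le] at hx'
          rcases hx' with h | h
          · exact hx (by rw [h0 _ (by linarith), h0 _ (by linarith)])
          · exact hx (by rw [h1 _ (by linarith), h1 _ (by linarith)])
      _ = _ := by rw [Real.volume_Icc]; norm_num
  | succ k ih =>
    set E := {x | F (x - l ^ k) ≠ F (x + l ^ k)} with hE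
    have hpre : ∀ c : ℝ, volume ((fun x => (x + c) / l) ⁻¹' E) = ENNReal.ofReal l * volume E := by
      intro c
      have : (fun x : ℝ => (x + c) / l) ⁻¹' E = (fun x => x + c) ⁻¹'
          ((fun x => x * l⁻¹) ⁻¹' E) := by
        ext x; simp [div_eq_mul_inv]
      rw [this, measure_preimage_add_right, Real.volume_preimage_mul_right (by positivity)]
      rw [inv_inv, abs_of_pos hl]
    have hsub : {x | F (x - l ^ (k + 1)) ≠ F (x + l ^ (k + 1))} ⊆
        ((fun x => (x + (1 - l) / 4) / l) ⁻¹' E) ∪ ((fun x => (x + -((1 - l) / 4)) / l) ⁻¹' E) := by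
      intro x hx
      by_contra hcon
      simp only [Set.mem_union, Set.mem_preimage, hE, Set.mem_ofPred_eq, not_or, not_not, ne_eq]
        at hcon hx
      apply hx
      rw [hF (x - _), hF (x + _)]
      have e : ∀ c, (x - l ^ (k + 1) + c) / l = (x + c) / l - l ^ k := fun c => by
        field_simp; ring
      have e' : ∀ c, (x + l ^ (k + 1) + c) / l = (x + c) / l + l ^ k := fun c => by
        field_simp; ring
      simp only [sub_eq_add_neg _ ((1 - l) / 4), e, e', hcon.1, hcon.2]
    calc _ ≤ _ := measure_mono hsub
      _ ≤ _ := measure_union_le _ _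
      _ = ENNReal.ofReal (2 * l) * volume E := by
        rw [hpre, hpre, ← add_mul, ← ENNReal.ofReal_add hl.le hl.le, two_mul]
      _ ≤ ENNReal.ofReal (2 * l) * ENNReal.ofReal (4 * (2 * l) ^ k) := by gcongr
      _ = _ := by
        rw [← ENNReal.ofReal_mul (by positivity)]
        congr 1; ring

lemma stair_eq_of_disjoint (hmono : Monotone F) {x y : ℝ} (hxy : x ≤ y)
    (h : ∀ z ∈ Set.Icc x y, ∃ e > 0, F (z - e) = F (z + e)) : F x = F y := by
  have key : ∀ z ∈ Set.Icc x y, ∀ᶠ w in 𝓝[Set.Icc x y] z, F w = F z := by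
    intro z hz
    obtain ⟨e, he, hF⟩ := h z hz
    refine mem_nhdsWithin_of_mem_nhds ?_
    filter_upwards [Ioo_mem_nhds (show z - e < z by linarith) (show z < z + e by linarith)]
        with w hw
    have a1 := hmono hw.1.le
    have a2 := hmono hw.2.le
    have a3 := hmono (show z - e ≤ z by linarith)
    have a4 := hmono (show z ≤ z + e by linarith)
    linarith
  exact isPreconnected_Icc.induction₂ (fun z w => F z = F w)
    (fun z hz => (key z hz).mono fun w hw => hw.symm) (fun _ _ _ _ _ _ h h' => h.trans h')
    (fun _ _ _ _ h => h.symm) (Set.left_mem_Icc.2 hxy) (Set.right_mem_Icc.2 hxy)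

end

theorem exists_staircase {D : ℝ} (hD : 0 < D) (hD1 : D < 1) : Nonempty (Staircase D) := by
  set l : ℝ := (1 / 2) ^ (1 / D) with hl_def
  have hl : 0 < l := by positivity
  have hl2 : l < 1 / 2 := by
    have := Real.rpow_lt_rpow_of_exponent_gt (show (0 : ℝ) < 1 / 2 by norm_num) (by norm_num)
      (show 1 < 1 / D by rw [lt_div_iff₀ hD]; linarith)
    rwa [Real.rpow_one] at this
  have hlD : l ^ D = 1 / 2 := by
    rw [hl_def, ← Real.rpow_mul (by norm_num), one_div_mul_cancel hD.ne', Real.rpow_one]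
  have h2l : l ^ (1 - D) = 2 * l := by
    rw [Real.rpow_sub hl, hlD, Real.rpow_one]; ring
  obtain ⟨F, hmono, h0, h1, hF⟩ := exists_stair hl (by linarith)
  set g := 1 / 2 - l with hg
  have hg0 : 0 < g := by linarith
  set C := {x | ∀ e > 0, F (x - e) ≠ F (x + e)} with hC
  have hosc : ∀ x y, x ≤ y → F y - F x ≤ 2 * g ^ (-D) * (y - x) ^ D := by
    intro x y hxy
    rcases hxy.eq_or_lt with rfl | hlt
    · simp [Real.zero_rpow hD.ne']
    have hd : 0 < y - x := by linarith
    have e0 : g ^ (-D) * (y - x) ^ D = ((y - x) / g) ^ D := by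
      rw [Real.div_rpow hd.le hg0.le, Real.rpow_neg hg0.le]; ring
    rw [mul_assoc, e0]
    by_cases hbig : (y - x) / g ≤ 1
    · obtain ⟨k, hk1, hk2⟩ := exists_scale hl (by linarith) (div_pos hd hg0) hbig
      have := stair_osc hl hl2 hmono h0 h1 hF k x y hxy (by
        rw [div_le_iff₀ hg0] at hk1; rw [mul_comm]; exact hk1)
      have h3 : (l ^ (k + 1)) ^ D ≤ ((y - x) / g) ^ D :=
        Real.rpow_le_rpow (by positivity) hk2.le hD.le
      rw [← Real.rpow_natCast, ← Real.rpow_mul hl.le, mul_comm, Real.rpow_mul hl.le, hlD,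
        Real.rpow_natCast, pow_succ] at h3
      linarith
    · push Not at hbig
      have : 1 ≤ ((y - x) / g) ^ D := Real.one_le_rpow hbig.le hD.le
      have := (stair_mem hmono h0 h1 x).1
      have := (stair_mem hmono h0 h1 y).2
      linarith
  have hne : C.Nonempty := by
    by_contra hcon
    have : F (-(1 / 4)) = F (1 / 4) := by
      refine stair_eq_of_disjoint hmono (by norm_num) fun z _ => ?_
      by_contra hz
      push Not at hz
      exact hcon ⟨z, fun e he => hz e he⟩
    rw [h0 _ le_rfl, h1 _ le_rfl] at this
    norm_num at this
  have hCsub : ∀ z ∈ C, |z| ≤ 1 / 4 := by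
    intro z hz
    by_contra hcon
    push Not at hcon
    rcases lt_abs.1 hcon with h | h
    · exact hz (z - 1 / 4) (by linarith) (by rw [h1 _ (by linarith), h1 _ (by linarith)])
    · exact hz (-z - 1 / 4) (by linarith) (by rw [h0 _ (by linarith), h0 _ (by linarith)])
  have hvol : ∀ r, 0 < r → r ≤ 1 → volume {x | Metric.infDist x C < r} ≤
      ENNReal.ofReal (4 / (2 * l) * r ^ (1 - D)) := by
    intro r hr hr1
    obtain ⟨k, hk1, hk2⟩ := exists_scale hl (by linarith) hr hr1
    refine (measure_mono ?_).trans ((stair_volume hl hl2 h0 h1 hF k).trans ?_)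
    · intro x hx
      obtain ⟨z, hz, hxz⟩ := (Metric.infDist_lt_iff hne).1 hx
      rw [Real.dist_eq] at hxz
      have hxz' := abs_lt.1 hxz
      set e := r - |x - z| with he
      have hne' := hz e (by linarith)
      have a1 : F (x - l ^ k) ≤ F (z - e) := hmono (by linarith [le_abs_self (x - z)])
      have a2 : F (z + e) ≤ F (x + l ^ k) := hmono (by linarith [neg_abs_le (x - z)])
      have a3 : F (z - e) ≤ F (z + e) := hmono (by linarith)
      intro heq
      exact hne' (le_antisymm a3 (by linarith))
    · refine ENNReal.ofReal_le_ofReal ?_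
      have h3 : (l ^ (k + 1)) ^ (1 - D) ≤ r ^ (1 - D) :=
        Real.rpow_le_rpow (by positivity) hk2.le (by linarith)
      rw [← Real.rpow_natCast, ← Real.rpow_mul hl.le, mul_comm, Real.rpow_mul hl.le, h2l,
        Real.rpow_natCast, pow_succ] at h3
      rw [div_mul_eq_mul_div, le_div_iff₀ (by positivity)]
      linarith
  refine ⟨{
    F := F
    d := fun x => Metric.infDist x C
    K := max (2 * g ^ (-D)) (4 / (2 * l))
    mono := hmono
    eq_zero := h0
    eq_one := h1
    holder := ?_
    d_nonneg := fun x => Metric.infDist_nonneg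
    d_lip := fun x y => by
      simpa [Real.dist_eq] using (Metric.lipschitz_infDist_pt C).dist_le_mul x y
    le_d := fun x => ?_
    d_le := fun x => ?_
    eq_of_lt := ?_
    volume_le := fun r hr hr1 => (hvol r hr hr1).trans (ENNReal.ofReal_le_ofReal
      (mul_le_mul_of_nonneg_right (le_max_right _ _) (by positivity))) }⟩
  · intro x y
    refine le_trans ?_ (mul_le_mul_of_nonneg_right (le_max_left _ _) (by positivity))
    rcases le_total x y with h | h
    · rw [abs_sub_comm (F x), abs_sub_comm x, abs_of_nonneg (sub_nonneg.2 (hmono h)),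
        abs_of_nonneg (sub_nonneg.2 h)]
      exact hosc _ _ h
    · rw [abs_of_nonneg (sub_nonneg.2 (hmono h)), abs_of_nonneg (sub_nonneg.2 h)]
      exact hosc _ _ h
  · refine (Metric.le_infDist hne).2 fun {z} hz => ?_
    rw [Real.dist_eq]
    linarith [hCsub z hz, abs_sub_abs_le_abs_sub x z]
  · obtain ⟨z, hz⟩ := hne
    refine (Metric.infDist_le_dist_of_mem hz).trans ?_
    rw [Real.dist_eq]
    linarith [hCsub z hz, abs_sub x z]
  · intro x y hxy
    have hloc : ∀ z, |z - x| < Metric.infDist x C → ∃ e > 0, F (z - e) = F (z + e) := by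
      intro z hz
      by_contra hcon
      push Not at hcon
      have : z ∈ C := fun e he => hcon e he
      have := Metric.infDist_le_dist_of_mem (x := x) this
      rw [dist_comm, Real.dist_eq] at this
      linarith
    rw [abs_lt] at hxy
    rcases le_total x y with h | h
    · refine (stair_eq_of_disjoint hmono h fun z hz => hloc z ?_).symm
      rw [abs_lt]; constructor <;> linarith [hz.1, hz.2]
    · refine stair_eq_of_disjoint hmono h fun z hz => hloc z ?_
      rw [abs_lt]; constructor <;> linarith [hz.1, hz.2]

/-- `log (1 / r)`, cut off from below at `e`. -/
def logInv (r : ℝ) : ℝ := max (exp 1) (log (1 / r))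

/-- The modulus `log log (1 / r) / log (1 / r)`, extended by a constant for large `r`. -/
def lam (r : ℝ) : ℝ := if r ≤ 0 then 0 else log (logInv r) / logInv r

lemma exp_one_le_logInv (r : ℝ) : exp 1 ≤ logInv r := le_max_left _ _

lemma logInv_pos (r : ℝ) : 0 < logInv r := (exp_pos 1).trans_le (exp_one_le_logInv r)

lemma one_le_log_logInv (r : ℝ) : 1 ≤ log (logInv r) := by
  rw [Real.le_log_iff_exp_le (logInv_pos r)]
  exact exp_one_le_logInv r

lemma logInv_anti {r r' : ℝ} (hr : 0 < r) (h : r ≤ r') : logInv r' ≤ logInv r :=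
  max_le_max le_rfl (Real.log_le_log (by have := hr.trans_le h; positivity)
    (one_div_le_one_div_of_le hr h))

lemma lam_of_pos {r : ℝ} (hr : 0 < r) : lam r = log (logInv r) / logInv r := if_neg hr.not_ge

lemma lam_of_nonpos {r : ℝ} (hr : r ≤ 0) : lam r = 0 := if_pos hr

lemma lam_pos {r : ℝ} (hr : 0 < r) : 0 < lam r := by
  rw [lam_of_pos hr]
  exact div_pos (by linarith [one_le_log_logInv r]) (logInv_pos r)

lemma lam_nonneg (r : ℝ) : 0 ≤ lam r := by
  rcases le_or_gt r 0 with h | h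
  · rw [lam_of_nonpos h]
  · exact (lam_pos h).le

lemma lam_mono : Monotone lam := by
  intro r r' h
  rcases le_or_gt r 0 with h0 | h0
  · rw [lam_of_nonpos h0]; exact lam_nonneg _
  · rw [lam_of_pos h0, lam_of_pos (h0.trans_le h)]
    exact Real.log_div_self_antitoneOn (exp_one_le_logInv r') (exp_one_le_logInv r)
      (logInv_anti h0 h)

/-- `s ↦ (log s / s) eˢ`, with `s` cut off at `e` in the first factor, is increasing. -/
lemma exp_mul_log_div_mono :
    Monotone fun s : ℝ => log (max (exp 1) s) / max (exp 1) s * exp s := by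
  have h1 : (1 : ℝ) ≤ exp 1 := Real.one_le_exp zero_le_one
  refine MonotoneOn.Iic_union_Ici (a := exp 1) ?_ ?_
  · intro s hs t ht hst
    simp only [max_eq_left (Set.mem_Iic.1 hs), max_eq_left (Set.mem_Iic.1 ht), log_exp]
    gcongr
  · intro s hs t ht hst
    have hs := Set.mem_Ici.1 hs
    have ht := Set.mem_Ici.1 ht
    simp only [max_eq_right hs, max_eq_right ht]
    have hs0 : 0 < s := (exp_pos 1).trans_le hs
    have ht0 : 0 < t := (exp_pos 1).trans_le ht
    have hlog : log s ≤ log t := Real.log_le_log hs0 hst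
    have hlog0 : 0 ≤ log s := Real.log_nonneg (h1.trans hs)
    have hexp : exp s / s ≤ exp t / t := by
      rw [div_le_div_iff₀ hs0 ht0]
      have : t / s ≤ exp (t - s) := by
        have h2 := Real.add_one_le_exp (t - s)
        refine le_trans ?_ h2
        rw [div_le_iff₀ hs0]
        nlinarith
      rw [div_le_iff₀ hs0] at this
      have h3 : exp t = exp s * exp (t - s) := by rw [← Real.exp_add]; ring_nf
      rw [h3]
      nlinarith [exp_pos s]
    calc log s / s * exp s = log s * (exp s / s) := by ring
      _ ≤ log t * (exp t / t) := by
        have := hlog0.trans hlog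
        gcongr
      _ = _ := by ring

lemma lam_mul_le {r r' : ℝ} (hr : 0 < r) (h : r ≤ r') : lam r' * r ≤ lam r * r' := by
  have hr' := hr.trans_le h
  have key := exp_mul_log_div_mono (Real.log_le_log (by positivity) (one_div_le_one_div_of_le hr h))
  simp only [Real.exp_log (one_div_pos.2 hr), Real.exp_log (one_div_pos.2 hr')] at key
  rw [mul_one_div, mul_one_div, div_le_div_iff₀ hr' hr] at key
  rw [lam_of_pos hr, lam_of_pos hr']
  exact key

lemma lam_scale {r c : ℝ} (hc : 1 ≤ c) : lam (c * r) ≤ c * lam r := by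
  rcases le_or_gt r 0 with h | h
  · rw [lam_of_nonpos h, lam_of_nonpos (mul_nonpos_of_nonneg_of_nonpos (by linarith) h), mul_zero]
  · have := lam_mul_le h (le_mul_of_one_le_left h.le hc)
    nlinarith

lemma lam_add_le {r r' : ℝ} (hr : 0 ≤ r) (hr' : 0 ≤ r') : lam (r + r') ≤ lam r + lam r' := by
  rcases hr.eq_or_lt with rfl | hr
  · simp [lam_nonneg]
  rcases hr'.eq_or_lt with rfl | hr'
  · simp [lam_nonneg]
  have h1 := lam_mul_le hr (show r ≤ r + r' by linarith)
  have h2 := lam_mul_le hr' (show r' ≤ r + r' by linarith)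
  have h3 : lam (r + r') * (r + r') ≤ (lam r + lam r') * (r + r') := by linarith
  exact le_of_mul_le_mul_right h3 (by linarith)

lemma tendsto_lam : Tendsto lam (𝓝 0) (𝓝 0) := by
  have h1 : Tendsto (fun r : ℝ => logInv r) (𝓝[>] 0) atTop := by
    refine tendsto_atTop_mono (fun r => le_max_right _ _) ?_
    simp only [one_div]
    exact Real.tendsto_log_atTop.comp tendsto_inv_nhdsGT_zero
  have h2 : Tendsto (fun s : ℝ => log s / s) atTop (𝓝 0) := by
    simpa using Real.isLittleO_log_id_atTop.tendsto_div_nhds_zero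
  have h3 : Tendsto lam (𝓝[>] 0) (𝓝 0) :=
    (h2.comp h1).congr' (by
      filter_upwards [self_mem_nhdsWithin] with r hr
      rw [lam_of_pos hr]; rfl)
  have h4 : Tendsto lam (𝓝[≤] 0) (𝓝 0) :=
    tendsto_const_nhds.congr' (by
      filter_upwards [self_mem_nhdsWithin] with r hr
      rw [lam_of_nonpos hr])
  have := h4.sup h3
  rwa [← nhdsWithin_union, Set.Iic_union_Ioi, nhdsWithin_univ] at this

/-- The truncated modulus. -/
def ell (k e r : ℝ) : ℝ := min e (k * lam r)

section
variable {k e : ℝ}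

lemma ell_nonneg (hk : 0 ≤ k) (he : 0 ≤ e) (r : ℝ) : 0 ≤ ell k e r :=
  le_min he (mul_nonneg hk (lam_nonneg r))

lemma ell_le (r : ℝ) : ell k e r ≤ e := min_le_left _ _

lemma ell_mono (hk : 0 ≤ k) : Monotone (ell k e) := fun _ _ h =>
  min_le_min le_rfl (mul_le_mul_of_nonneg_left (lam_mono h) hk)

lemma ell_of_nonpos (he : 0 ≤ e) {r : ℝ} (hr : r ≤ 0) : ell k e r = 0 := by
  simp [ell, lam_of_nonpos hr, he]

lemma ell_pos (hk : 0 < k) (he : 0 < e) {r : ℝ} (hr : 0 < r) : 0 < ell k e r :=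
  lt_min he (mul_pos hk (lam_pos hr))

lemma ell_sub_le (hk : 0 ≤ k) (r r' : ℝ) :
    |ell k e r - ell k e r'| ≤ k * lam |r - r'| := by
  wlog h : r' ≤ r generalizing r r'
  · rw [abs_sub_comm, abs_sub_comm r]
    exact this r' r (by linarith)
  rw [abs_of_nonneg (sub_nonneg.2 (ell_mono hk h)), abs_of_nonneg (sub_nonneg.2 h)]
  have hl : lam r ≤ lam r' + lam (r - r') := by
    rcases le_or_gt r' 0 with h0 | h0
    · rw [lam_of_nonpos h0, zero_add]; exact lam_mono (by linarith)
    · simpa using lam_add_le h0.le (sub_nonneg.2 h)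
  have hl2 := mul_le_mul_of_nonneg_left hl hk
  have h0 := mul_nonneg hk (lam_nonneg (r - r'))
  unfold ell
  rcases le_total e (k * lam r') with h1 | h1
  · rw [min_eq_left h1]
    linarith [min_le_left e (k * lam r)]
  · rw [min_eq_right h1]
    linarith [min_le_right e (k * lam r)]

/-- The odd extension of the truncated modulus. -/
def oddEll (k e r : ℝ) : ℝ := ell k e r - ell k e (-r)

lemma oddEll_sub_le (hk : 0 ≤ k) (r r' : ℝ) :
    |oddEll k e r - oddEll k e r'| ≤ 2 * k * lam |r - r'| := by
  have h1 := ell_sub_le (e := e) hk r r'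
  have h2 := ell_sub_le (e := e) hk (-r) (-r')
  have h3 : |-r - -r'| = |r - r'| := by rw [abs_sub_comm]; ring_nf
  rw [h3] at h2
  unfold oddEll
  rw [abs_le] at *
  constructor <;> linarith

lemma oddEll_of_nonneg (he : 0 ≤ e) {r : ℝ} (hr : 0 ≤ r) : oddEll k e r = ell k e r := by
  rw [oddEll, ell_of_nonpos he (neg_nonpos.2 hr), sub_zero]

lemma oddEll_of_nonpos (he : 0 ≤ e) {r : ℝ} (hr : r ≤ 0) : oddEll k e r = -ell k e (-r) := by
  rw [oddEll, ell_of_nonpos he hr, zero_sub]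

lemma abs_oddEll_le (hk : 0 ≤ k) (he : 0 ≤ e) (r : ℝ) : |oddEll k e r| ≤ e := by
  rcases le_total 0 r with h | h
  · rw [oddEll_of_nonneg he h, abs_of_nonneg (ell_nonneg hk he r)]; exact ell_le r
  · rw [oddEll_of_nonpos he h, abs_neg, abs_of_nonneg (ell_nonneg hk he _)]; exact ell_le _

/-- The gain in integrability produced by the modulus. -/
lemma exists_rpow_ell_le (hk : 2 ≤ k) (he : 0 < e) :
    ∃ C : ℝ, 0 < C ∧ ∀ r, 0 < r → r ≤ 1 → r ^ ell k e r ≤ C * logInv r ^ (-2 : ℝ) := by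
  have h1 : Tendsto (fun s : ℝ => s ^ (2 : ℝ) * exp (-e * s)) atTop (𝓝 0) :=
    tendsto_rpow_mul_exp_neg_mul_atTop_nhds_zero 2 e he
  obtain ⟨S, hS⟩ := eventually_atTop.1 (h1.eventually (gt_mem_nhds one_pos))
  set M := max S (exp 1) with hM
  have hM0 : 0 < M := (exp_pos 1).trans_le (le_max_right _ _)
  have hM1 : 1 ≤ M := (Real.one_le_exp zero_le_one).trans (le_max_right _ _)
  refine ⟨M ^ (2 : ℝ), by positivity, fun r hr hr1 => ?_⟩
  rw [Real.rpow_neg (logInv_pos r).le, ← div_eq_mul_inv, le_div_iff₀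
      (by have := logInv_pos r; positivity)]
  have hle : r ^ ell k e r ≤ 1 :=
    Real.rpow_le_one hr.le hr1 (ell_nonneg (by linarith) he.le r)
  by_cases hs : logInv r ≤ M
  · calc r ^ ell k e r * logInv r ^ (2 : ℝ) ≤ 1 * M ^ (2 : ℝ) := by
          have := logInv_pos r
          gcongr
      _ = _ := one_mul _
  · push Not at hs
    have hlog : logInv r = log (1 / r) := by
      rcases max_choice (exp 1) (log (1 / r)) with h | h
      · exfalso
        have : logInv r = exp 1 := h
        linarith [le_max_right S (exp 1)]
      · exact h
    have hlr : log r = -logInv r := by rw [hlog, one_div, Real.log_inv, neg_neg]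
    have hpow : ∀ q, r ^ q = exp (-logInv r * q) := fun q => by
      rw [Real.rpow_def_of_pos hr, hlr]
    have hM2 : 1 ≤ M ^ (2 : ℝ) := Real.one_le_rpow hM1 (by norm_num)
    refine le_trans ?_ hM2
    rcases min_choice e (k * lam r) with h | h
    · rw [ell, h, hpow]
      have := hS (logInv r) ((le_max_left _ _).trans hs.le)
      rw [mul_comm, show -logInv r * e = -e * logInv r by ring]
      exact this.le
    · rw [ell, h, hpow, lam_of_pos hr]
      have e1 : -logInv r * (k * (log (logInv r) / logInv r)) = log (logInv r) * (-k) := by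
        field_simp [(logInv_pos r).ne']
      rw [e1, ← Real.rpow_def_of_pos (logInv_pos r), ← Real.rpow_add (logInv_pos r)]
      exact Real.rpow_le_one_of_one_le_of_nonpos (by linarith) (by linarith)

/-- A field of size `δ⁻ˢ` raised to an exponent below the critical one by the modulus. -/
lemma exists_rpow_le_weight {s q₀ C : ℝ} (hs : 0 < s) (hq₀ : 0 ≤ q₀) (hk : 2 ≤ s * k) (he : 0 < e)
    (hC : 1 ≤ C) : ∃ C' : ℝ, 0 < C' ∧ ∀ δ, 0 < δ → ∀ q, 0 ≤ q → q ≤ q₀ - ell k e (δ / 4) →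
      ∀ b, 0 ≤ b → b ≤ C * δ ^ (-s) →
        b ^ q ≤ C' * (1 + δ ^ (-(s * q₀)) * logInv δ ^ (-2 : ℝ)) := by
  have hk0 : 0 ≤ k := by by_contra h; push Not at h; nlinarith
  obtain ⟨A, hA, hAr⟩ := exists_rpow_ell_le (k := s * k) (e := s * e) hk (mul_pos hs he)
  refine ⟨C ^ q₀ * max 1 (4 ^ (s * e) * A), by positivity, fun δ hδ q hq hqle b hb hbC => ?_⟩
  have hW : 0 ≤ δ ^ (-(s * q₀)) * logInv δ ^ (-2 : ℝ) := by
    have := logInv_pos δ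
    positivity
  have hell := ell_nonneg hk0 he.le (δ / 4)
  have hCq : (1 : ℝ) ≤ C ^ q₀ := Real.one_le_rpow hC hq₀
  rcases le_or_gt 1 δ with h1 | h1
  · have h2 : δ ^ (-s) ≤ 1 := Real.rpow_le_one_of_one_le_of_nonpos h1 (by linarith)
    have h3 : b ≤ C := hbC.trans (mul_le_of_le_one_right (by linarith) h2)
    calc b ^ q ≤ C ^ q := Real.rpow_le_rpow hb h3 hq
      _ ≤ C ^ q₀ := Real.rpow_le_rpow_of_exponent_le hC (by linarith)
      _ = C ^ q₀ * 1 * 1 := by ring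
      _ ≤ _ := by
        gcongr
        · exact le_max_left _ _
        · linarith
  · have h2 : 1 ≤ δ ^ (-s) := Real.one_le_rpow_of_pos_of_le_one_of_nonpos hδ h1.le (by linarith)
    have h3 : 1 ≤ C * δ ^ (-s) := by nlinarith
    have hscale : s * ell k e (δ / 4) = ell (s * k) (s * e) (δ / 4) := by
      rw [ell, ell, mul_min_of_nonneg _ _ hs.le, mul_assoc]
    have h4 := hAr (δ / 4) (by linarith) (by linarith)
    rw [← hscale, Real.div_rpow hδ.le (by norm_num), div_le_iff₀ (by positivity)] at h4
    have h5 : logInv (δ / 4) ^ (-2 : ℝ) ≤ logInv δ ^ (-2 : ℝ) :=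
      Real.rpow_le_rpow_of_nonpos (logInv_pos _) (logInv_anti (by linarith) (by linarith))
        (by norm_num)
    have h6 : (4 : ℝ) ^ (s * ell k e (δ / 4)) ≤ 4 ^ (s * e) :=
      Real.rpow_le_rpow_of_exponent_le (by norm_num)
        (mul_le_mul_of_nonneg_left (ell_le _) hs.le)
    have hl0 := logInv_pos δ
    have hl1 := logInv_pos (δ / 4)
    calc b ^ q ≤ (C * δ ^ (-s)) ^ q := Real.rpow_le_rpow hb hbC hq
      _ ≤ (C * δ ^ (-s)) ^ (q₀ - ell k e (δ / 4)) := Real.rpow_le_rpow_of_exponent_le h3 hqle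
      _ = C ^ (q₀ - ell k e (δ / 4)) * (δ ^ (-(s * q₀)) * δ ^ (s * ell k e (δ / 4))) := by
        rw [Real.mul_rpow (by linarith) (by positivity), ← Real.rpow_mul hδ.le,
          ← Real.rpow_add hδ]
        ring_nf
      _ ≤ C ^ q₀ * (δ ^ (-(s * q₀)) * (A * logInv δ ^ (-2 : ℝ) * 4 ^ (s * e))) := by
        have h7 := h4.trans (show _ ≤ A * logInv δ ^ (-2 : ℝ) * 4 ^ (s * e) by gcongr)
        gcongr
        linarith
      _ = C ^ q₀ * (4 ^ (s * e) * A) * (δ ^ (-(s * q₀)) * logInv δ ^ (-2 : ℝ)) := by ring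
      _ ≤ _ := by
        gcongr
        · exact le_max_right _ _
        · linarith

end

section
variable {α : Type*} [MeasurableSpace α] {ν : Measure α} {δ : α → ℝ} {m C : ℝ}

lemma ae_pos_of_measure_lt (hm : 0 < m)
    (hν : ∀ r, 0 < r → r ≤ 1 → ν {x | δ x < r} ≤ ENNReal.ofReal (C * r ^ m)) :
    ∀ᵐ x ∂ν, 0 < δ x := by
  rw [ae_iff]
  have h1 : Tendsto (fun r : ℝ => ENNReal.ofReal (C * r ^ m)) (𝓝[>] 0) (𝓝 0) := by
    have : Tendsto (fun r : ℝ => C * r ^ m) (𝓝[>] 0) (𝓝 (C * 0 ^ m)) :=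
      (((Real.continuousAt_rpow_const 0 m (Or.inr hm.le)).tendsto).mono_left
        nhdsWithin_le_nhds).const_mul C
    rw [Real.zero_rpow hm.ne', mul_zero] at this
    simpa using (ENNReal.tendsto_ofReal this)
  refine le_antisymm (ge_of_tendsto h1 ?_) bot_le
  filter_upwards [Ioc_mem_nhdsGT one_pos] with r hr
  refine (measure_mono fun x hx => ?_).trans (hν r hr.1 hr.2)
  simp only [Set.mem_ofPred_eq, not_lt] at hx ⊢
  linarith [hr.1]

/-- Dyadic estimate for the integral of a function of `δ`. -/
lemma lintegral_dyadic_lt_top [IsFiniteMeasure ν] (hδ : Measurable δ) (hm : 0 < m)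
    (hν : ∀ r, 0 < r → r ≤ 1 → ν {x | δ x < r} ≤ ENNReal.ofReal (C * r ^ m))
    {φ : ℝ → ℝ} {A : ℝ} {a : ℕ → ℝ} (ha : ∀ k, 0 ≤ a k)
    (hφA : ∀ r, 1 ≤ r → φ r ≤ A)
    (hφ : ∀ k : ℕ, ∀ r, (1 / 2 : ℝ) ^ (k + 1) < r → r ≤ (1 / 2 : ℝ) ^ k → φ r ≤ a k)
    (hsum : Summable fun k : ℕ => a k * ((1 / 2 : ℝ) ^ k) ^ m) :
    ∫⁻ x, ENNReal.ofReal (φ (δ x)) ∂ν < ⊤ := by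
  have hν2 : ∀ r, 0 < r → r ≤ 1 → ν {x | δ x ≤ r} ≤
      ENNReal.ofReal (max C (ν.real .univ) * (2 * r) ^ m) := by
    intro r hr hr1
    rcases le_or_gt (2 * r) 1 with h | h
    · refine (measure_mono fun x hx => ?_).trans ((hν (2 * r) (by linarith) h).trans ?_)
      · simp only [Set.mem_ofPred_eq] at hx ⊢; linarith
      · apply ENNReal.ofReal_le_ofReal
        gcongr
        exact le_max_left _ _
    · calc ν {x | δ x ≤ r} ≤ ν .univ := measure_mono (Set.subset_univ _)
        _ = ENNReal.ofReal (ν.real .univ) := by simp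
        _ ≤ _ := by
          apply ENNReal.ofReal_le_ofReal
          have h1 : 1 ≤ (2 * r) ^ m := Real.one_le_rpow h.le hm.le
          have h2 := le_max_right C (ν.real .univ)
          have h3 : 0 ≤ ν.real .univ := measureReal_nonneg
          nlinarith
  set B := max C (ν.real .univ) with hB
  have hB0 : 0 ≤ B := measureReal_nonneg.trans (le_max_right _ _)
  have hpt : ∀ᵐ x ∂ν, ENNReal.ofReal (φ (δ x)) ≤ ENNReal.ofReal A +
      ∑' k : ℕ, {x | δ x ≤ (1 / 2 : ℝ) ^ k}.indicator (fun _ => ENNReal.ofReal (a k)) x := by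
    filter_upwards [ae_pos_of_measure_lt hm hν] with x hx
    rcases le_or_gt 1 (δ x) with h | h
    · exact (ENNReal.ofReal_le_ofReal (hφA _ h)).trans le_self_add
    · obtain ⟨k, h1, h2⟩ := exists_nat_pow_near_of_lt_one hx h.le (show (0 : ℝ) < 1 / 2 by norm_num)
        (by norm_num)
      refine le_trans ?_ le_add_self
      refine le_trans ?_ (ENNReal.le_tsum k)
      rw [Set.indicator_of_mem (show x ∈ {x | δ x ≤ (1 / 2 : ℝ) ^ k} from h2)]
      exact ENNReal.ofReal_le_ofReal (hφ k _ h1 h2)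
  refine (lintegral_mono_ae hpt).trans_lt ?_
  rw [lintegral_add_left measurable_const, lintegral_tsum]
  · refine ENNReal.add_lt_top.2 ⟨?_, ?_⟩
    · rw [lintegral_const]
      exact ENNReal.mul_lt_top ENNReal.ofReal_lt_top (measure_lt_top _ _)
    · calc _ ≤ ∑' k : ℕ, ENNReal.ofReal (B * 2 ^ m * (a k * ((1 / 2 : ℝ) ^ k) ^ m)) := by
            refine ENNReal.tsum_le_tsum fun k => ?_
            rw [lintegral_indicator (measurableSet_le hδ measurable_const), setLIntegral_const]
            refine (mul_le_mul_right (hν2 _ (by positivity)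
                (pow_le_one₀ (by norm_num) (by norm_num))) _).trans ?_
            rw [← ENNReal.ofReal_mul (ha k)]
            refine ENNReal.ofReal_le_ofReal (le_of_eq ?_)
            rw [Real.mul_rpow (by norm_num) (by positivity)]
            ring
        _ < ⊤ := (hsum.mul_left _).tsum_ofReal_lt_top
  · intro k
    exact (measurable_const.indicator (measurableSet_le hδ measurable_const)).aemeasurable

lemma lintegral_weight_lt_top [IsFiniteMeasure ν] (hδ : Measurable δ) (hm : 0 < m)
    (hν : ∀ r, 0 < r → r ≤ 1 → ν {x | δ x < r} ≤ ENNReal.ofReal (C * r ^ m)) :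
    ∫⁻ x, ENNReal.ofReal (δ x ^ (-m) * logInv (δ x) ^ (-2 : ℝ)) ∂ν < ⊤ := by
  refine lintegral_dyadic_lt_top (φ := fun r => r ^ (-m) * logInv r ^ (-2 : ℝ)) hδ hm hν (A := 1)
    (a := fun k => ((1 / 2 : ℝ) ^ (k + 1)) ^ (-m) * (((k : ℝ) + 1) / 4) ^ (-2 : ℝ))
    (fun k => by positivity) ?_ ?_ ?_
  · intro r hr
    have h1 : r ^ (-m) ≤ 1 := Real.rpow_le_one_of_one_le_of_nonpos hr (by linarith)
    have h2 : logInv r ^ (-2 : ℝ) ≤ 1 := Real.rpow_le_one_of_one_le_of_nonpos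
      ((Real.one_le_exp zero_le_one).trans (exp_one_le_logInv r)) (by norm_num)
    have h0 := logInv_pos r
    exact mul_le_one₀ h1 (by positivity) h2
  · intro k r h1 h2
    have hr : 0 < r := lt_trans (by positivity) h1
    have hlog : ((k : ℝ) + 1) / 4 ≤ logInv r := by
      have e1 : log ((2 : ℝ) ^ k) ≤ log (1 / r) := by
        apply Real.log_le_log (by positivity)
        rw [le_div_iff₀ hr]
        calc (2 : ℝ) ^ k * r ≤ 2 ^ k * (1 / 2) ^ k := by gcongr
          _ = 1 := by rw [← mul_pow]; norm_num
      rw [Real.log_pow] at e1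
      have e2 : exp 1 ≤ logInv r := le_max_left _ _
      have e3 : log (1 / r) ≤ logInv r := le_max_right _ _
      have e4 := Real.log_two_gt_d9
      have e5 := Real.add_one_le_exp 1
      have e6 : (0 : ℝ) ≤ k := k.cast_nonneg
      nlinarith
    have a1 : r ^ (-m) ≤ ((1 / 2 : ℝ) ^ (k + 1)) ^ (-m) :=
      Real.rpow_le_rpow_of_nonpos (by positivity) h1.le (by linarith)
    have a2 : logInv r ^ (-2 : ℝ) ≤ (((k : ℝ) + 1) / 4) ^ (-2 : ℝ) :=
      Real.rpow_le_rpow_of_nonpos (by positivity) hlog (by norm_num)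
    have := logInv_pos r
    gcongr
  · have h1 : Summable fun k : ℕ => (((k : ℝ) + 1) ^ 2)⁻¹ := by
      have := (summable_nat_add_iff 1).2 (Real.summable_nat_pow_inv.2 (show 1 < 2 by norm_num))
      simpa using this
    refine (h1.mul_left (2 ^ m * 16)).congr fun k => ?_
    have e1 : ((1 / 2 : ℝ) ^ (k + 1)) ^ (-m) * ((1 / 2 : ℝ) ^ k) ^ m = 2 ^ m := by
      rw [pow_succ, Real.mul_rpow (by positivity) (by positivity), Real.rpow_neg (by positivity),
        Real.rpow_neg (by positivity), Real.div_rpow (x := 1) (by norm_num) (by norm_num),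
            Real.one_rpow]
      field_simp
    have e2 : (((k : ℝ) + 1) / 4) ^ (-2 : ℝ) = 16 * (((k : ℝ) + 1) ^ 2)⁻¹ := by
      rw [Real.rpow_neg (by positivity), Real.rpow_ofNat]
      field_simp; norm_num
    rw [e2, ← e1]
    ring

lemma integrable_inv_of_measure_lt [IsFiniteMeasure ν] (hδ : Measurable δ) (hm : 1 < m)
    (hδ0 : ∀ x, 0 ≤ δ x)
    (hν : ∀ r, 0 < r → r ≤ 1 → ν {x | δ x < r} ≤ ENNReal.ofReal (C * r ^ m)) :
    Integrable (fun x => (δ x)⁻¹) ν := by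
  refine ⟨hδ.inv.aestronglyMeasurable, ?_⟩
  rw [hasFiniteIntegral_iff_ofReal (ae_of_all _ fun x => inv_nonneg.2 (hδ0 x))]
  refine lintegral_dyadic_lt_top (φ := fun r => r⁻¹) hδ (by linarith) hν (A := 1)
    (a := fun k => ((1 / 2 : ℝ) ^ (k + 1))⁻¹) (fun k => by positivity) ?_ ?_ ?_
  · intro r hr
    exact inv_le_one_of_one_le₀ hr
  · intro k r h1 h2
    exact inv_anti₀ (by positivity) h1.le
  · have h1 : Summable fun k : ℕ => ((1 / 2 : ℝ) ^ (m - 1)) ^ k :=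
      summable_geometric_of_lt_one (by positivity)
        (Real.rpow_lt_one (by norm_num) (by norm_num) (by linarith))
    refine (h1.mul_left 2).congr fun k => ?_
    rw [← Real.rpow_natCast, ← Real.rpow_mul (by norm_num), ← Real.rpow_natCast (1 / 2) k,
      ← Real.rpow_mul (by norm_num), pow_succ, mul_inv, ← Real.rpow_natCast (1 / 2) k,
      ← Real.rpow_neg (by norm_num)]
    rw [mul_right_comm, ← Real.rpow_add (by norm_num), mul_comm]
    congr 1
    · ring_nf
    · norm_num

end

section
variable {E : Type*} [NormedAddCommGroup E]

/-- A bounded function that coincides on `{ε ≤ δ}` with a `C ε⁻ˢ`-Lipschitz function, for every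
`0 < ε ≤ 1`. -/
def RegAway (δ : E → ℝ) (s : ℝ) (u : E → ℝ) : Prop :=
  ∃ C M : ℝ, 0 ≤ C ∧ 0 ≤ M ∧ (∀ x, |u x| ≤ M) ∧ ∀ ε, 0 < ε → ε ≤ 1 →
    ∃ v : E → ℝ, (∀ x y, |v x - v y| ≤ C * ε ^ (-s) * ‖x - y‖) ∧ (∀ x, |v x| ≤ M) ∧
      ∀ x, ε ≤ δ x → v x = u x

variable {δ u : E → ℝ} {s : ℝ}

lemma eventuallyEq_of_eqOn_le {v : E → ℝ} (hδ : Continuous δ) {ε : ℝ} {x : E} (hx : ε < δ x)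
    (h : ∀ y, ε ≤ δ y → v y = u y) : v =ᶠ[𝓝 x] u := by
  filter_upwards [hδ.continuousAt.eventually (lt_mem_nhds hx)] with y hy
  exact h y hy.le

lemma lipschitz_of_abs_sub_le {v : E → ℝ} {K : ℝ} (h : ∀ x y, |v x - v y| ≤ K * ‖x - y‖) :
    LipschitzWith K.toNNReal v :=
  LipschitzWith.of_dist_le' fun x y => by rw [Real.dist_eq, dist_eq_norm]; exact h x y

lemma RegAway.cutoff (h : RegAway δ s u) (hs : 0 ≤ s) {f χ : E → ℝ} {Kf Mf Kχ : ℝ}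
    (hf : ∀ x y, |f x - f y| ≤ Kf * ‖x - y‖) (hfM : ∀ x, |f x| ≤ Mf)
    (hχ : ∀ x y, |χ x - χ y| ≤ Kχ * ‖x - y‖) (hχM : ∀ x, |χ x| ≤ 1) :
    RegAway δ s (fun x => f x + χ x * (u x - f x)) := by
  obtain ⟨C, M, hC, hM, huM, hv⟩ := h
  have hMf : 0 ≤ Mf := (abs_nonneg _).trans (hfM 0)
  have hb : ∀ w : E → ℝ, (∀ x, |w x| ≤ M) → ∀ x, |f x + χ x * (w x - f x)| ≤ 2 * Mf + M := by
    intro w hw x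
    calc |f x + χ x * (w x - f x)| ≤ |f x| + |χ x * (w x - f x)| := abs_add_le _ _
      _ ≤ Mf + 1 * (M + Mf) := by
        rw [abs_mul]
        gcongr
        · exact hfM x
        · exact hχM x
        · exact (abs_sub _ _).trans (add_le_add (hw x) (hfM x))
      _ = _ := by ring
  refine ⟨2 * |Kf| + C + |Kχ| * (M + Mf), 2 * Mf + M, by positivity, by positivity, hb u huM,
    fun ε hε hε1 => ?_⟩
  obtain ⟨v, hL, hvM, hE⟩ := hv ε hε hε1
  refine ⟨fun x => f x + χ x * (v x - f x), fun x y => ?_, hb v hvM, fun x hx => by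
    simp only [hE x hx]⟩
  have h1 : (1 : ℝ) ≤ ε ^ (-s) := Real.one_le_rpow_of_pos_of_le_one_of_nonpos hε hε1 (by linarith)
  have e : f x + χ x * (v x - f x) - (f y + χ y * (v y - f y)) =
      (f x - f y) + χ x * ((v x - v y) - (f x - f y)) + (χ x - χ y) * (v y - f y) := by ring
  have hn := norm_nonneg (x - y)
  have hf' : |f x - f y| ≤ |Kf| * ‖x - y‖ := (hf x y).trans (by gcongr; exact le_abs_self _)
  have hχ' : |χ x - χ y| ≤ |Kχ| * ‖x - y‖ := (hχ x y).trans (by gcongr; exact le_abs_self _)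
  dsimp only
  rw [e]
  calc _ ≤ |f x - f y| + |χ x * ((v x - v y) - (f x - f y))| + |(χ x - χ y) * (v y - f y)| :=
        (abs_add_le _ _).trans (add_le_add_left (abs_add_le _ _) _)
    _ ≤ |Kf| * ‖x - y‖ + 1 * (C * ε ^ (-s) * ‖x - y‖ + |Kf| * ‖x - y‖) +
        |Kχ| * ‖x - y‖ * (M + Mf) := by
      rw [abs_mul, abs_mul]
      gcongr
      · exact hχM x
      · exact (abs_sub _ _).trans (add_le_add (hL x y) hf')
      · exact (abs_sub _ _).trans (add_le_add (hvM y) (hfM y))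
    _ = (2 * |Kf| * 1 + C * ε ^ (-s) + |Kχ| * (M + Mf) * 1) * ‖x - y‖ := by ring
    _ ≤ (2 * |Kf| * ε ^ (-s) + C * ε ^ (-s) + |Kχ| * (M + Mf) * ε ^ (-s)) * ‖x - y‖ := by gcongr
    _ = _ := by ring

variable [NormedSpace ℝ E]

lemma RegAway.norm_fderiv_le (h : RegAway δ s u) (hδ : Continuous δ) (hs : 0 ≤ s) :
    ∃ C : ℝ, 0 ≤ C ∧ ∀ x, 0 < δ x → ‖fderiv ℝ u x‖ ≤ C * (1 + δ x ^ (-s)) := by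
  obtain ⟨C, M, hC, -, -, hv⟩ := h
  refine ⟨C * 2 ^ s, by positivity, fun x hx => ?_⟩
  obtain ⟨v, hL, -, hE⟩ := hv (min (δ x / 2) 1) (lt_min (by linarith) one_pos) (min_le_right _ _)
  have heq := eventuallyEq_of_eqOn_le hδ
    ((min_le_left (δ x / 2) 1).trans_lt (show δ x / 2 < δ x by linarith)) hE
  rw [← heq.fderiv_eq]
  have hpos : 0 ≤ C * (min (δ x / 2) 1) ^ (-s) := mul_nonneg hC (Real.rpow_nonneg (by positivity) _)
  have h1 := norm_fderiv_le_of_lipschitz ℝ (lipschitz_of_abs_sub_le hL) (x₀ := x)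
  rw [Real.coe_toNNReal _ hpos] at h1
  refine h1.trans ?_
  rw [mul_assoc]
  refine mul_le_mul_of_nonneg_left ?_ hC
  have h2 : (1 : ℝ) ≤ 2 ^ s := Real.one_le_rpow (by norm_num) hs
  have h3 : 0 ≤ δ x ^ (-s) := by positivity
  rcases le_total (δ x / 2) 1 with h | h
  · rw [min_eq_left h, Real.div_rpow hx.le (by norm_num), Real.rpow_neg (x := 2) (by norm_num),
        div_inv_eq_mul]
    nlinarith
  · rw [min_eq_right h, Real.one_rpow]
    nlinarith

lemma RegAway.ae_differentiableAt [FiniteDimensional ℝ E] [MeasurableSpace E] [BorelSpace E]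
    {μ : Measure E} [μ.IsAddHaarMeasure] {s' : Set E} (h : RegAway δ s u) (hδ : Continuous δ)
    (hpos : ∀ᵐ x ∂μ.restrict s', 0 < δ x) : ∀ᵐ x ∂μ.restrict s', DifferentiableAt ℝ u x := by
  obtain ⟨C, M, hC, -, -, hv⟩ := h
  choose v hL _ hE using fun k : ℕ => hv (1 / ((k : ℝ) + 1)) (by positivity)
    (by rw [div_le_one (by positivity)]; linarith [k.cast_nonneg (α := ℝ)])
  have hd : ∀ᵐ x ∂μ.restrict s', ∀ k, DifferentiableAt ℝ (v k) x :=
    ae_all_iff.2 fun k => ae_restrict_of_ae (lipschitz_of_abs_sub_le (hL k)).ae_differentiableAt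
  filter_upwards [hd, hpos] with x hx hx0
  obtain ⟨k, hk⟩ := exists_nat_one_div_lt hx0
  exact (eventuallyEq_of_eqOn_le hδ hk (hE k)).differentiableAt_iff.1 (hx k)

end

section
variable {N : ℕ} {δ u : Euc N → ℝ} {s : ℝ}

lemma isOpen_omg : IsOpen (Omg N) := Metric.isOpen_ball

lemma gradient_apply (f : Euc N → ℝ) (x : Euc N) (i : Fin N) :
    gradient f x i = fderiv ℝ f x (EuclideanSpace.single i 1) := by
  have := InnerProductSpace.toDual_symm_apply (𝕜 := ℝ) (x := EuclideanSpace.single i (1 : ℝ))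
    (y := fderiv ℝ f x)
  rw [← this, gradient, real_inner_comm]
  simp [EuclideanSpace.inner_single_left]

lemma norm_gradient (f : Euc N → ℝ) (x : Euc N) : ‖gradient f x‖ = ‖fderiv ℝ f x‖ := by
  simp [gradient]

lemma measurable_gradient (f : Euc N → ℝ) : Measurable (gradient f) :=
  (InnerProductSpace.toDual ℝ (Euc N)).symm.continuous.measurable.comp (measurable_fderiv ℝ f)

instance : IsFiniteMeasure (volume.restrict (Omg N)) :=
  ⟨by rw [Measure.restrict_apply_univ]; exact measure_ball_lt_top⟩

lemma IsTestFun.bounded {φ : Euc N → ℝ} (hφ : IsTestFun N φ) : ∃ B, ∀ x, |φ x| ≤ B := by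
  simpa using hφ.1.continuous.bounded_above_of_compact_support hφ.2.1

lemma IsTestFun.lipschitz {φ : Euc N → ℝ} (hφ : IsTestFun N φ) : ∃ K, LipschitzWith K φ :=
  ContDiff.lipschitzWith_of_hasCompactSupport hφ.2.1 hφ.1 (by simp)

lemma IsTestFun.differentiable {φ : Euc N → ℝ} (hφ : IsTestFun N φ) : Differentiable ℝ φ :=
  hφ.1.differentiable (by simp)

/-- A directional derivative of a test function is a test function. -/
lemma IsTestFun.fderiv_apply {φ : Euc N → ℝ} (hφ : IsTestFun N φ) (v : Euc N) :
    IsTestFun N (fun x => fderiv ℝ φ x v) := by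
  refine ⟨(hφ.1.fderiv_right (m := (⊤ : ℕ∞)) (by simp)).clm_apply contDiff_const,
    hφ.2.1.fderiv_apply ℝ v, ?_⟩
  exact (tsupport_fderiv_apply_subset ℝ v).trans hφ.2.2

lemma IsTestFun.eq_zero {φ : Euc N → ℝ} (hφ : IsTestFun N φ) {x : Euc N} (hx : x ∉ Omg N) :
    φ x = 0 := image_eq_zero_of_notMem_tsupport fun h => hx (hφ.2.2 h)

lemma RegAway.aestronglyMeasurable (h : RegAway δ s u)
    (hpos : ∀ᵐ x ∂volume.restrict (Omg N), 0 < δ x) :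
    AEStronglyMeasurable u (volume.restrict (Omg N)) := by
  obtain ⟨C, M, hC, -, -, hv⟩ := h
  choose v hL _ hE using fun k : ℕ => hv (1 / ((k : ℝ) + 1)) (by positivity)
    (by rw [div_le_one (by positivity)]; linarith [k.cast_nonneg (α := ℝ)])
  refine aestronglyMeasurable_of_tendsto_ae atTop (f := v)
    (fun k => (lipschitz_of_abs_sub_le (hL k)).continuous.aestronglyMeasurable) ?_
  filter_upwards [hpos] with x hx
  obtain ⟨k₀, hk₀⟩ := exists_nat_one_div_lt hx
  refine tendsto_const_nhds.congr' ?_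
  filter_upwards [eventually_ge_atTop k₀] with k hk
  exact (hE k x ((one_div_le_one_div_of_le (by positivity) (by gcongr)).trans hk₀.le)).symm

lemma RegAway.integrableOn (h : RegAway δ s u) (hpos : ∀ᵐ x ∂volume.restrict (Omg N), 0 < δ x) :
    IntegrableOn u (Omg N) := by
  have hm := h.aestronglyMeasurable hpos
  obtain ⟨C, M, hC, -, hM, hv⟩ := h
  exact Integrable.of_bound hm M (ae_of_all _ hM)

lemma rpow_neg_le_one_add_inv {r : ℝ} (hr : 0 < r) (hs : 0 ≤ s) (hs1 : s ≤ 1) :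
    r ^ (-s) ≤ 1 + r⁻¹ := by
  have hi : 0 < r⁻¹ := inv_pos.2 hr
  rcases le_total r 1 with h | h
  · have := Real.rpow_le_rpow_of_exponent_ge hr h (show -1 ≤ -s by linarith)
    rw [Real.rpow_neg_one] at this
    linarith
  · linarith [Real.rpow_le_one_of_one_le_of_nonpos h (show -s ≤ 0 by linarith)]

lemma RegAway.hasWeakGradOn (h : RegAway δ s u) (hδ : Continuous δ) (hs : 0 ≤ s) (hs1 : s ≤ 1)
    (hpos : ∀ᵐ x ∂volume.restrict (Omg N), 0 < δ x)
    (hint : Integrable (fun x => (δ x)⁻¹) (volume.restrict (Omg N))) :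
    HasWeakGradOn N u (gradient u) := by
  obtain ⟨G, hG, hgrad⟩ := h.norm_fderiv_le hδ hs
  have hgrad' : ∀ᵐ x ∂volume.restrict (Omg N), ‖fderiv ℝ u x‖ ≤ G * (2 + (δ x)⁻¹) := by
    filter_upwards [hpos] with x hx
    refine (hgrad x hx).trans (mul_le_mul_of_nonneg_left ?_ hG)
    linarith [rpow_neg_le_one_add_inv hx hs hs1]
  have hintG : Integrable (fun x => G * (2 + (δ x)⁻¹)) (volume.restrict (Omg N)) :=
    ((integrable_const 2).add hint).const_mul G
  refine ⟨(h.integrableOn hpos).locallyIntegrableOn, ?_, fun φ hφ i => ?_⟩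
  · refine Integrable.mono' hintG (measurable_gradient u).aestronglyMeasurable ?_
    filter_upwards [hgrad'] with x hx
    rwa [norm_gradient]
  have hu := h.integrableOn hpos
  obtain ⟨C, M, hC, hM, huM, hv⟩ := h
  choose v hL hvM hE using fun k : ℕ => hv (1 / ((k : ℝ) + 1)) (by positivity)
    (by rw [div_le_one (by positivity)]; linarith [k.cast_nonneg (α := ℝ)])
  set e : Euc N := EuclideanSpace.single i 1
  have hlip := fun k => lipschitz_of_abs_sub_le (hL k)
  have hdiff : ∀ᵐ x ∂volume.restrict (Omg N), ∀ k, DifferentiableAt ℝ (v k) x :=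
    ae_all_iff.2 fun k => ae_restrict_of_ae (hlip k).ae_differentiableAt
  have hφ' := hφ.fderiv_apply e
  obtain ⟨B, hB⟩ := hφ.bounded
  obtain ⟨B', hB'⟩ := hφ'.bounded
  obtain ⟨Kφ, hKφ⟩ := hφ.lipschitz
  have hB0 : 0 ≤ B := (abs_nonneg _).trans (hB 0)
  have hibp : ∀ k, ∫ x in Omg N, v k x * fderiv ℝ φ x e =
      -∫ x in Omg N, fderiv ℝ (v k) x e * φ x := by
    intro k
    have h1 := (hlip k).integral_lineDeriv_mul_eq (μ := volume) hKφ hφ.2.1 e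
    rw [setIntegral_eq_integral_of_forall_compl_eq_zero fun x hx => by
        rw [hφ'.eq_zero hx, mul_zero],
      setIntegral_eq_integral_of_forall_compl_eq_zero fun x hx => by
        rw [hφ.eq_zero hx, mul_zero]]
    have h2 : ∫ x, fderiv ℝ (v k) x e * φ x = ∫ x, lineDeriv ℝ (v k) x e * φ x := by
      refine integral_congr_ae ?_
      filter_upwards [(hlip k).ae_differentiableAt] with x hx
      rw [hx.lineDeriv_eq_fderiv]
    rw [h2, h1, ← integral_neg]
    refine integral_congr_ae (ae_of_all _ fun x => ?_)
    dsimp only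
    rw [(hφ.differentiable x).lineDeriv_eq_fderiv, map_neg]
    ring
  have hev : ∀ x, 0 < δ x → ∀ᶠ k : ℕ in atTop, 1 / ((k : ℝ) + 1) < δ x := by
    intro x hx
    obtain ⟨k₀, hk₀⟩ := exists_nat_one_div_lt hx
    filter_upwards [eventually_ge_atTop k₀] with k hk
    exact (one_div_le_one_div_of_le (by positivity) (by gcongr)).trans_lt hk₀
  have hlim1 : Tendsto (fun k => ∫ x in Omg N, v k x * fderiv ℝ φ x e) atTop
      (𝓝 (∫ x in Omg N, u x * fderiv ℝ φ x e)) := by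
    refine tendsto_integral_of_dominated_convergence (fun _ => M * B')
      (fun k => ((hlip k).continuous.mul hφ'.1.continuous).aestronglyMeasurable)
      (integrable_const _) ?_ ?_
    · refine fun k => ae_of_all _ fun x => ?_
      rw [Real.norm_eq_abs, abs_mul]
      exact mul_le_mul (hvM k x) (hB' x) (abs_nonneg _) hM
    · filter_upwards [hpos] with x hx
      refine tendsto_const_nhds.congr' ?_
      filter_upwards [hev x hx] with k hk
      rw [hE k x hk.le]
  have hlim2 : Tendsto (fun k => ∫ x in Omg N, fderiv ℝ (v k) x e * φ x) atTop
      (𝓝 (∫ x in Omg N, fderiv ℝ u x e * φ x)) := by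
    refine tendsto_integral_of_dominated_convergence
      (fun x => (G * (2 + (δ x)⁻¹) + C * (1 + (δ x)⁻¹)) * ‖e‖ * B)
      (fun k => ((measurable_fderiv_apply_const ℝ (v k) e).mul
        hφ.1.continuous.measurable).aestronglyMeasurable) ?_ ?_ ?_
    · exact ((hintG.add (((integrable_const 1).add hint).const_mul C)).mul_const _).mul_const _
    · intro k
      filter_upwards [hpos, hgrad'] with x hx hgx
      rw [norm_mul]
      refine mul_le_mul ?_ (hB x) (norm_nonneg _) ?_
      · refine (ContinuousLinearMap.le_opNorm _ _).trans ?_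
        refine mul_le_mul_of_nonneg_right ?_ (norm_nonneg _)
        have hi : 0 < (δ x)⁻¹ := inv_pos.2 hx
        rcases lt_or_ge (1 / ((k : ℝ) + 1)) (δ x) with hk | hk
        · rw [(eventuallyEq_of_eqOn_le hδ hk (hE k)).fderiv_eq]
          refine hgx.trans ?_
          have : 0 ≤ C * (1 + (δ x)⁻¹) := by positivity
          linarith
        · have h1 := norm_fderiv_le_of_lipschitz ℝ (hlip k) (x₀ := x)
          rw [Real.coe_toNNReal _ (by positivity)] at h1
          have h2 : (1 / ((k : ℝ) + 1)) ^ (-s) ≤ δ x ^ (-s) :=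
            Real.rpow_le_rpow_of_nonpos hx hk (by linarith)
          have h3 := rpow_neg_le_one_add_inv hx hs hs1
          have h4 := mul_le_mul_of_nonneg_left (h2.trans h3) hC
          have : 0 ≤ G * (2 + (δ x)⁻¹) := by positivity
          linarith
      · have hi : 0 < (δ x)⁻¹ := inv_pos.2 hx
        positivity
    · filter_upwards [hpos] with x hx
      refine tendsto_const_nhds.congr' ?_
      filter_upwards [hev x hx] with k hk
      rw [(eventuallyEq_of_eqOn_le hδ hk (hE k)).fderiv_eq]
  have h3 := tendsto_nhds_unique (hlim1.congr hibp) hlim2.neg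
  simp only [gradient_apply]
  exact h3

end

section
variable {N : ℕ}

lemma lintegral_rpow_lt_top {δ q : Euc N → ℝ} {g : Euc N → Euc N} {s q₀ k e C Cν Δ : ℝ}
    (hδ : Continuous δ) (hpos : ∀ᵐ x ∂volume.restrict (Omg N), 0 < δ x)
    (hΔ : ∀ x ∈ Omg N, δ x ≤ Δ) (hs : 0 < s) (hq₀ : 0 < q₀) (hk : 2 ≤ s * k) (he : 0 < e)
    (hν : ∀ r, 0 < r → r ≤ 1 →
      volume.restrict (Omg N) {x | δ x < r} ≤ ENNReal.ofReal (Cν * r ^ (s * q₀)))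
    (hq : ∀ x, 0 ≤ q x) (hC : 0 ≤ C) (hg : ∀ x, 0 < δ x → ‖g x‖ ≤ C * (1 + δ x ^ (-s)))
    (hgq : ∀ᵐ x ∂volume.restrict (Omg N), g x ≠ 0 → q x ≤ q₀ - ell k e (δ x / 4)) :
    ∫⁻ x in Omg N, ENNReal.ofReal (‖g x‖ ^ q x) < ⊤ := by
  set Δ' := max Δ 1
  have hΔ' : 1 ≤ Δ' := le_max_right _ _
  set C₁ := (C + 1) * (Δ' ^ s + 1)
  have hΔs : 1 ≤ Δ' ^ s := Real.one_le_rpow hΔ' hs.le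
  have hC₁ : 1 ≤ C₁ * 1 := by
    simp only [C₁]; nlinarith
  have hmain : ∀ x ∈ Omg N, 0 < δ x → 1 ≤ Δ' ^ s * δ x ^ (-s) := by
    intro x hx hx0
    rw [Real.rpow_neg hx0.le, ← div_eq_mul_inv, one_le_div (by positivity)]
    exact Real.rpow_le_rpow hx0.le ((hΔ x hx).trans (le_max_left _ _)) hs.le
  obtain ⟨C', hC', hw⟩ := exists_rpow_le_weight hs hq₀.le hk he (C := C₁) (by linarith)
  have hmem : ∀ᵐ x ∂volume.restrict (Omg N), x ∈ Omg N := ae_restrict_mem isOpen_omg.measurableSet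
  have hfin : ∫⁻ x in Omg N, (ENNReal.ofReal (1 + C') + ENNReal.ofReal C' *
      ENNReal.ofReal (δ x ^ (-(s * q₀)) * logInv (δ x) ^ (-2 : ℝ))) < ⊤ := by
    rw [lintegral_add_left measurable_const, lintegral_const_mul' _ _ ENNReal.ofReal_ne_top]
    refine ENNReal.add_lt_top.2 ⟨?_, ENNReal.mul_lt_top ENNReal.ofReal_lt_top
      (lintegral_weight_lt_top hδ.measurable (mul_pos hs hq₀) hν)⟩
    rw [lintegral_const]
    exact ENNReal.mul_lt_top ENNReal.ofReal_lt_top (measure_lt_top _ _)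
  refine lt_of_le_of_lt (lintegral_mono_ae ?_) hfin
  filter_upwards [hpos, hgq, hmem] with x hx hxq hxm
  have hwt : 0 ≤ δ x ^ (-(s * q₀)) * logInv (δ x) ^ (-2 : ℝ) :=
    mul_nonneg (Real.rpow_nonneg hx.le _) (Real.rpow_nonneg (logInv_pos _).le _)
  rw [← ENNReal.ofReal_mul hC'.le, ← ENNReal.ofReal_add (by positivity) (by positivity)]
  apply ENNReal.ofReal_le_ofReal
  by_cases h0 : g x = 0
  · rw [h0, norm_zero]
    have : (0 : ℝ) ^ q x ≤ 1 := Real.rpow_le_one le_rfl zero_le_one (hq x)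
    nlinarith
  · have h1 := hw (δ x) hx (q x) (hq x) (hxq h0) ‖g x‖ (norm_nonneg _) ?_
    · linarith
    · refine (hg x hx).trans ?_
      have h2 := hmain x hxm hx
      have h3 : 0 ≤ δ x ^ (-s) := by positivity
      calc C * (1 + δ x ^ (-s)) ≤ (C + 1) * (Δ' ^ s * δ x ^ (-s) + δ x ^ (-s)) := by
            gcongr
            linarith
        _ = _ := by simp only [C₁]; ring

lemma energy_upper {p : Euc N → ℝ} {g : Euc N → Euc N} {p₀ : ℝ}
    (hpm : Measurable p) (hgm : Measurable g) (hp : ∀ x, 0 < p x)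
    (hg : ∀ᵐ x ∂volume.restrict (Omg N), g x ≠ 0 → p x < p₀)
    (hfin : ∫⁻ x in Omg N, ENNReal.ofReal (‖g x‖ ^ p x) < ⊤) {c : ℝ} (hc : 0 < c) :
    ∃ t₁ : ℝ, ∀ t, t₁ ≤ t →
      ∫⁻ x in Omg N, ENNReal.ofReal (‖t • g x‖ ^ p x) < ENNReal.ofReal (c * t ^ p₀) := by
  have hlim : Tendsto (fun t : ℝ => ∫⁻ x in Omg N, ENNReal.ofReal (t ^ (p x - p₀) * ‖g x‖ ^ p x))
      atTop (𝓝 (∫⁻ x in Omg N, 0)) := by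
    refine tendsto_lintegral_filter_of_dominated_convergence
      (fun x => ENNReal.ofReal (‖g x‖ ^ p x)) ?_ ?_ hfin.ne ?_
    · refine Eventually.of_forall fun t => ?_
      exact ((measurable_const.pow (hpm.sub_const _)).mul (hgm.norm.pow hpm)).ennreal_ofReal
    · filter_upwards [eventually_ge_atTop 1] with t ht
      filter_upwards [hg] with x hx
      apply ENNReal.ofReal_le_ofReal
      by_cases h0 : g x = 0
      · rw [h0, norm_zero, Real.zero_rpow (hp x).ne', mul_zero]
      · have : t ^ (p x - p₀) ≤ 1 :=
          Real.rpow_le_one_of_one_le_of_nonpos ht (by linarith [hx h0])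
        exact mul_le_of_le_one_left (by positivity) this
    · filter_upwards [hg] with x hx
      by_cases h0 : g x = 0
      · simp [h0, Real.zero_rpow (hp x).ne']
      · have h1 := tendsto_rpow_neg_atTop (y := p₀ - p x) (by linarith [hx h0])
        have h2 := ENNReal.tendsto_ofReal (h1.mul_const (‖g x‖ ^ p x))
        rw [zero_mul, ENNReal.ofReal_zero] at h2
        refine h2.congr fun t => ?_
        rw [neg_sub]
  rw [lintegral_zero] at hlim
  have hev := hlim.eventually (gt_mem_nhds (show (0 : ℝ≥0∞) < ENNReal.ofReal c by simpa using hc))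
  obtain ⟨t₁, ht₁⟩ := (hev.and (eventually_gt_atTop 0)).exists_forall_of_atTop
  refine ⟨t₁, fun t ht => ?_⟩
  obtain ⟨h1, h0⟩ := ht₁ t ht
  have h2 : ∫⁻ x in Omg N, ENNReal.ofReal (‖t • g x‖ ^ p x) = ENNReal.ofReal (t ^ p₀) *
      ∫⁻ x in Omg N, ENNReal.ofReal (t ^ (p x - p₀) * ‖g x‖ ^ p x) := by
    rw [← lintegral_const_mul' _ _ ENNReal.ofReal_ne_top]
    congr 1
    ext x
    rw [← ENNReal.ofReal_mul (by positivity), norm_smul, Real.norm_of_nonneg h0.le,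
      Real.mul_rpow h0.le (norm_nonneg _), ← mul_assoc, ← Real.rpow_add h0]
    congr 3
    ring
  rw [h2, mul_comm c, ENNReal.ofReal_mul (by positivity)]
  exact ENNReal.mul_lt_mul_right (by simpa using Real.rpow_pos_of_pos h0 _) ENNReal.ofReal_ne_top h1

end

section
variable {N : ℕ}

lemma IsTestFun.smooth_mul {η φ : Euc N → ℝ} (hη : ContDiff ℝ (⊤ : ℕ∞) η) (hφ : IsTestFun N φ) :
    IsTestFun N (fun x => η x * φ x) :=
  ⟨hη.mul hφ.1, hφ.2.1.mul_left, (tsupport_mul_subset_right (f := η)).trans hφ.2.2⟩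

lemma fderiv_fderiv_comm {φ : Euc N → ℝ} (hφ : ContDiff ℝ (⊤ : ℕ∞) φ) (x a b : Euc N) :
    fderiv ℝ (fun y => fderiv ℝ φ y a) x b = fderiv ℝ (fun y => fderiv ℝ φ y b) x a := by
  have hd : DifferentiableAt ℝ (fderiv ℝ φ) x :=
    (hφ.fderiv_right (m := (⊤ : ℕ∞)) (by simp)).differentiable (by simp) x
  have h (c : Euc N) (d : Euc N) :
      fderiv ℝ (fun y => fderiv ℝ φ y c) x d = fderiv ℝ (fderiv ℝ φ) x d c := by
    rw [fderiv_clm_apply hd (differentiableAt_const c)]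
    simp
  rw [h, h]
  exact (hφ.contDiffAt.isSymmSndFDerivAt (by
    rw [minSmoothness_of_isRCLikeNormedField]; exact WithTop.coe_le_coe.2
        (le_top : (2 : ℕ∞) ≤ ⊤))).eq b a

/-- The `2`-form `dφ ∧ dv` integrates to zero against a function that does not depend on the two
coordinates involved. -/
lemma HasWeakGradOn.integral_cross_eq_zero {v η φ : Euc N → ℝ} {g : Euc N → Euc N}
    (h : HasWeakGradOn N v g) (hη : ContDiff ℝ (⊤ : ℕ∞) η) {i j : Fin N}
    (hi : ∀ x, fderiv ℝ η x (EuclideanSpace.single i 1) = 0)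
    (hj : ∀ x, fderiv ℝ η x (EuclideanSpace.single j 1) = 0) (hφ : IsTestFun N φ) :
    ∫ x in Omg N, g x j * (η x * gradient φ x i) =
      ∫ x in Omg N, g x i * (η x * gradient φ x j) := by
  have key : ∀ (a : Fin N) (b : Euc N) (x : Euc N),
      fderiv ℝ η x (EuclideanSpace.single a 1) = 0 →
      fderiv ℝ (fun y => η y * fderiv ℝ φ y b) x (EuclideanSpace.single a 1) =
        η x * fderiv ℝ (fun y => fderiv ℝ φ y b) x (EuclideanSpace.single a 1) := by
    intro a b x hx
    rw [fderiv_fun_mul (hη.differentiable (by simp) x) ((hφ.fderiv_apply b).differentiable x)]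
    simp [hx]
  have h1 := h.2.2 _ ((hφ.fderiv_apply (EuclideanSpace.single i 1)).smooth_mul hη) j
  have h2 := h.2.2 _ ((hφ.fderiv_apply (EuclideanSpace.single j 1)).smooth_mul hη) i
  simp only [gradient_apply φ]
  rw [← neg_inj, ← h1, ← h2]
  congr 1
  ext x
  rw [key _ _ _ (hj x), key _ _ _ (hi x), fderiv_fderiv_comm hφ.1]

lemma abs_cross_le (a b : Euc N) (i j : Fin N) (r : ℝ) (hr : 0 ≤ r) :
    |b j * (r * a i) - b i * (r * a j)| ≤ ‖a‖ * (2 * r * ‖b‖) := by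
  have h (c : Euc N) (l : Fin N) : |c l| ≤ ‖c‖ := by simpa using PiLp.norm_apply_le c l
  calc _ ≤ |b j * (r * a i)| + |b i * (r * a j)| := abs_sub _ _
    _ = |b j| * (r * |a i|) + |b i| * (r * |a j|) := by simp only [abs_mul, abs_of_nonneg hr]
    _ ≤ ‖b‖ * (r * ‖a‖) + ‖b‖ * (r * ‖a‖) := by gcongr <;> exact h _ _
    _ = _ := by ring

lemma young_rpow_le {a b l q q₀ : ℝ} (ha : 0 ≤ a) (hb : 0 ≤ b) (hl : 1 ≤ l) (hq₀ : 1 < q₀)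
    (hq : 1 < q) (hqq : b ≠ 0 → q₀ ≤ q) :
    l * (a * b) ≤ a ^ q + l ^ (q₀ / (q₀ - 1)) * b ^ (q / (q - 1)) := by
  by_cases hb0 : b = 0
  · rw [hb0]
    have : 0 ≤ a ^ q := by positivity
    have : (0 : ℝ) ≤ 0 ^ (q / (q - 1)) := Real.rpow_nonneg le_rfl _
    have : 0 ≤ l ^ (q₀ / (q₀ - 1)) := by positivity
    nlinarith [mul_nonneg this ‹(0 : ℝ) ≤ 0 ^ (q / (q - 1))›]
  have hqq := hqq hb0
  have hconj : q.HolderConjugate (q / (q - 1)) := Real.HolderConjugate.conjExponent hq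
  have h1 := Real.young_inequality_of_nonneg ha (show 0 ≤ l * b by positivity) hconj
  have h2 : a ^ q / q ≤ a ^ q := div_le_self (by positivity) hq.le
  have h3 : (l * b) ^ (q / (q - 1)) / (q / (q - 1)) ≤ (l * b) ^ (q / (q - 1)) :=
    div_le_self (by positivity) hconj.symm.lt.le
  have h4 : (l * b) ^ (q / (q - 1)) ≤ l ^ (q₀ / (q₀ - 1)) * b ^ (q / (q - 1)) := by
    rw [Real.mul_rpow (by linarith) hb]
    refine mul_le_mul_of_nonneg_right (Real.rpow_le_rpow_of_exponent_le hl ?_) (by positivity)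
    rw [div_le_div_iff₀ (by linarith) (by linarith)]
    nlinarith
  calc l * (a * b) = a * (l * b) := by ring
    _ ≤ _ := by linarith

lemma energy_lower {p v η f : Euc N → ℝ} {g : Euc N → Euc N} {p₀ : ℝ} (hp₀ : 1 < p₀)
    (hpm : Measurable p) (hp : ∀ x, 1 < p x) (hv : HasWeakGradOn N v g) (hgm : Measurable g)
    (hη : ContDiff ℝ (⊤ : ℕ∞) η) (hη0 : ∀ x, 0 ≤ η x) (hη1 : ∀ x, η x ≤ 1) {i j : Fin N}
    (hi : ∀ x, fderiv ℝ η x (EuclideanSpace.single i 1) = 0)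
    (hj : ∀ x, fderiv ℝ η x (EuclideanSpace.single j 1) = 0)
    {Kf : ℝ} (hf : ∀ x, ‖gradient f x‖ ≤ Kf)
    (hc : ∫ x in Omg N, (g x j * (η x * gradient f x i) - g x i * (η x * gradient f x j)) ≠ 0)
    (hpg : ∀ᵐ x ∂volume.restrict (Omg N), η x ≠ 0 → g x ≠ 0 → p₀ ≤ p x)
    (hB : ∫⁻ x in Omg N, ENNReal.ofReal ((2 * η x * ‖g x‖) ^ (p x / (p x - 1))) < ⊤) :
    ∃ c : ℝ, 0 < c ∧ ∃ t₁ : ℝ, ∀ t, t₁ ≤ t → ∀ φ, IsTestFun N φ →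
      ENNReal.ofReal (c * t ^ p₀) ≤
        ∫⁻ x in Omg N, ENNReal.ofReal (‖t • gradient f x + gradient φ x‖ ^ p x) := by
  set c₀ := |∫ x in Omg N, (g x j * (η x * gradient f x i) - g x i * (η x * gradient f x j))|
  have hc₀ : 0 < c₀ := abs_pos.2 hc
  set B := (∫⁻ x in Omg N, ENNReal.ofReal ((2 * η x * ‖g x‖) ^ (p x / (p x - 1)))).toReal
  have hB0 : 0 ≤ B := ENNReal.toReal_nonneg
  -- the tangential energy of every smooth competitor is bounded below
  have htest : ∀ t : ℝ, 0 ≤ t → ∀ φ, IsTestFun N φ → ENNReal.ofReal (t * c₀) ≤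
      ∫⁻ x in Omg N, ENNReal.ofReal (‖t • gradient f x + gradient φ x‖ * (2 * η x * ‖g x‖)) := by
    intro t ht φ hφ
    obtain ⟨Kφ, hKφ⟩ := hφ.lipschitz
    have hint : ∀ (h : Euc N → ℝ) (K : ℝ), (∀ x, ‖gradient h x‖ ≤ K) → ∀ a b : Fin N,
        Integrable (fun x => g x a * (η x * gradient h x b)) (volume.restrict (Omg N)) := by
      intro h K hK a b
      have hga : Integrable (fun x => g x a) (volume.restrict (Omg N)) :=
        (EuclideanSpace.proj (𝕜 := ℝ) a).integrable_comp hv.2.1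
      refine hga.mul_bdd (c := K) ?_ (ae_of_all _ fun x => ?_)
      · have : Measurable fun x => gradient h x b :=
          (EuclideanSpace.proj (𝕜 := ℝ) b).measurable.comp (measurable_gradient h)
        exact (hη.continuous.measurable.mul this).aestronglyMeasurable
      · rw [norm_mul, Real.norm_of_nonneg (hη0 x)]
        have : ‖gradient h x b‖ ≤ ‖gradient h x‖ := PiLp.norm_apply_le _ _
        nlinarith [hη0 x, hη1 x, norm_nonneg (gradient h x b), hK x]
    have hKφ' : ∀ x, ‖gradient φ x‖ ≤ Kφ := fun x => by
      rw [norm_gradient]; exact norm_fderiv_le_of_lipschitz ℝ hKφ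
    have hcross := hv.integral_cross_eq_zero hη hi hj hφ
    set G : Euc N → Euc N := fun x => t • gradient f x + gradient φ x
    have hsplit : ∀ x, g x j * (η x * G x i) - g x i * (η x * G x j) =
        t * (g x j * (η x * gradient f x i) - g x i * (η x * gradient f x j)) +
        (g x j * (η x * gradient φ x i) - g x i * (η x * gradient φ x j)) := by
      intro x; simp only [G, PiLp.add_apply, PiLp.smul_apply, smul_eq_mul]; ring
    have hI : ∫ x in Omg N, (g x j * (η x * G x i) - g x i * (η x * G x j)) =
        t * ∫ x in Omg N, (g x j * (η x * gradient f x i) - g x i * (η x * gradient f x j)) := by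
      simp only [hsplit]
      have e1 : Integrable (fun x => g x j * (η x * gradient f x i) -
          g x i * (η x * gradient f x j)) (volume.restrict (Omg N)) :=
              (hint f Kf hf j i).sub (hint f Kf hf i j)
      have e2 : Integrable (fun x => g x j * (η x * gradient φ x i) -
          g x i * (η x * gradient φ x j)) (volume.restrict (Omg N)) :=
              (hint φ Kφ hKφ' j i).sub (hint φ Kφ hKφ' i j)
      rw [integral_add (e1.const_mul t) e2, integral_const_mul,
        integral_sub (hint φ Kφ hKφ' j i) (hint φ Kφ hKφ' i j), hcross, sub_self, add_zero]
    have h1 : t * c₀ = ‖∫ x in Omg N, (g x j * (η x * G x i) - g x i * (η x * G x j))‖ := by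
      rw [hI, norm_mul, Real.norm_of_nonneg ht, Real.norm_eq_abs]
    rw [h1, ofReal_norm]
    refine (enorm_integral_le_lintegral_enorm _).trans (lintegral_mono fun x => ?_)
    rw [← ofReal_norm, Real.norm_eq_abs]
    exact ENNReal.ofReal_le_ofReal (abs_cross_le _ _ _ _ _ (hη0 x))
  have hq₀ : 0 < p₀ / (p₀ - 1) - 1 := by
    rw [div_sub_one (by linarith)]; apply div_pos <;> linarith
  have hmain : ∀ t l : ℝ, 0 ≤ t → 1 ≤ l → ∀ φ, IsTestFun N φ →
      ENNReal.ofReal (l * (t * c₀) - l ^ (p₀ / (p₀ - 1)) * B) ≤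
        ∫⁻ x in Omg N, ENNReal.ofReal (‖t • gradient f x + gradient φ x‖ ^ p x) := by
    intro t l ht hl φ hφ
    have hl0 : 0 ≤ l := by linarith
    have h1 := htest t ht φ hφ
    have hY : ∀ᵐ x ∂volume.restrict (Omg N), ENNReal.ofReal l *
        ENNReal.ofReal (‖t • gradient f x + gradient φ x‖ * (2 * η x * ‖g x‖)) ≤
        ENNReal.ofReal (‖t • gradient f x + gradient φ x‖ ^ p x) +
        ENNReal.ofReal (l ^ (p₀ / (p₀ - 1))) *
          ENNReal.ofReal ((2 * η x * ‖g x‖) ^ (p x / (p x - 1))) := by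
      filter_upwards [hpg] with x hx
      have hb : 0 ≤ 2 * η x * ‖g x‖ := by have := hη0 x; positivity
      rw [← ENNReal.ofReal_mul hl0, ← ENNReal.ofReal_mul (by positivity),
        ← ENNReal.ofReal_add (by positivity) (by positivity)]
      refine ENNReal.ofReal_le_ofReal (young_rpow_le (norm_nonneg _) hb hl hp₀ (hp x) fun h => ?_)
      refine hx (fun h0 => h (by rw [h0]; ring)) (fun h0 => h (by rw [h0]; simp))
    have h2 := lintegral_mono_ae hY
    rw [lintegral_const_mul' _ _ ENNReal.ofReal_ne_top, lintegral_add_right,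
        lintegral_const_mul' _ _ ENNReal.ofReal_ne_top] at h2
    · rw [← ENNReal.ofReal_toReal hB.ne] at h2
      rw [ENNReal.ofReal_sub _ (by positivity), tsub_le_iff_right, ENNReal.ofReal_mul hl0,
        ENNReal.ofReal_mul (p := l ^ (p₀ / (p₀ - 1))) (by positivity)]
      exact (mul_le_mul_right h1 _).trans h2
    · refine Measurable.const_mul ?_ _
      exact (((hη.continuous.measurable.const_mul 2).mul hgm.norm).pow
        (hpm.div (hpm.sub_const 1))).ennreal_ofReal
  -- optimise the parameter
  have hk : ∃ κ : ℝ, 0 < κ ∧ κ ^ (p₀ / (p₀ - 1) - 1) * B ≤ c₀ / 2 := by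
    have hlim : Tendsto (fun κ : ℝ => κ ^ (p₀ / (p₀ - 1) - 1) * B) (𝓝[>] 0) (𝓝 0) := by
      have : ContinuousAt (fun κ : ℝ => κ ^ (p₀ / (p₀ - 1) - 1) * B) 0 :=
        (Real.continuousAt_rpow_const _ _ (Or.inr hq₀.le)).mul continuousAt_const
      have h := this.tendsto
      rw [Real.zero_rpow hq₀.ne', zero_mul] at h
      exact h.mono_left nhdsWithin_le_nhds
    obtain ⟨κ, h1, h2⟩ := ((hlim.eventually (ge_mem_nhds (half_pos hc₀))).and
      self_mem_nhdsWithin).exists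
    exact ⟨κ, h2, h1⟩
  obtain ⟨κ, hκ, hκB⟩ := hk
  have hlt := ((tendsto_rpow_atTop (show 0 < p₀ - 1 by linarith)).const_mul_atTop
    hκ).eventually_ge_atTop 1
  obtain ⟨t₁, ht₁⟩ := (hlt.and (eventually_gt_atTop 0)).exists_forall_of_atTop
  refine ⟨κ * c₀ / 2, by positivity, t₁, fun t ht φ hφ => ?_⟩
  obtain ⟨h1, h0⟩ := ht₁ t ht
  refine le_trans (ENNReal.ofReal_le_ofReal ?_) (hmain t _ h0.le h1 φ hφ)
  have e1 : t ^ (p₀ - 1) * t = t ^ p₀ := by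
    rw [← Real.rpow_add_one h0.ne']; congr 1; ring
  have e2 : (κ * t ^ (p₀ - 1)) ^ (p₀ / (p₀ - 1)) = κ ^ (p₀ / (p₀ - 1) - 1) * κ * t ^ p₀ := by
    rw [Real.mul_rpow hκ.le (by positivity), ← Real.rpow_mul h0.le,
      mul_div_cancel₀ _ (by linarith), ← Real.rpow_add_one hκ.ne']
    congr 2
    ring
  rw [e2]
  have e3 : κ * t ^ (p₀ - 1) * (t * c₀) = κ * t ^ p₀ * c₀ := by rw [← e1]; ring
  rw [e3]
  have e4 := mul_le_mul_of_nonneg_left hκB (show 0 ≤ κ * t ^ p₀ by positivity)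
  nlinarith

end

section
variable {N : ℕ}

lemma HasWeakGradOn.const_smul {w : Euc N → ℝ} {g : Euc N → Euc N}
    (h : HasWeakGradOn N w g) (t : ℝ) :
    HasWeakGradOn N (fun x => t * w x) (fun x => t • g x) := by
  refine ⟨fun x hx => ?_, h.2.1.smul t, fun φ hφ i => ?_⟩
  · obtain ⟨s, hs, hi⟩ := h.1 x hx
    exact ⟨s, hs, hi.const_mul t⟩
  · have := h.2.2 φ hφ i
    simp only [PiLp.smul_apply, smul_eq_mul, mul_assoc]
    rw [integral_const_mul, integral_const_mul, this]
    ring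

lemma ell_mul {c k e : ℝ} (hc : 0 ≤ c) (r : ℝ) : ell (c * k) (c * e) r = c * ell k e r := by
  simp only [ell]
  rw [mul_min_of_nonneg _ _ hc, mul_assoc]

lemma continuous_oddEll {k e : ℝ} (hk : 0 ≤ k) : Continuous (oddEll k e) := by
  refine continuous_iff_continuousAt.2 fun x => tendsto_iff_dist_tendsto_zero.2 ?_
  have h1 : Tendsto (fun y => 2 * k * lam |y - x|) (𝓝 x) (𝓝 0) := by
    have h2 : Tendsto (fun y : ℝ => |y - x|) (𝓝 x) (𝓝 0) := by
      have : Continuous fun y : ℝ => |y - x| := by fun_prop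
      simpa using this.tendsto x
    simpa using (tendsto_lam.comp h2).const_mul (2 * k)
  exact squeeze_zero (fun _ => dist_nonneg) (fun y => oddEll_sub_le hk y x) h1

lemma lam_eq {r : ℝ} (hr : 0 < r) (h : r ≤ exp (-exp 1)) :
    lam r = (log (1 / r))⁻¹ * log (log (1 / r)) := by
  have h1 : exp 1 ≤ log (1 / r) := by
    rw [one_div, Real.log_inv, le_neg, ← Real.log_exp (-exp 1)]
    exact Real.log_le_log hr h
  rw [lam_of_pos hr, logInv, max_eq_right h1, div_eq_inv_mul]

lemma rpow_add_le_add {z C₁ q Q : ℝ} (hz : 0 ≤ z) (hC₁ : 1 ≤ C₁) (hq : 0 ≤ q) (hqQ : q ≤ Q) :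
    (C₁ * (1 + z)) ^ q ≤ (2 * C₁) ^ Q + (2 * C₁ * z) ^ q := by
  have h1 : 0 ≤ (2 * C₁ * z) ^ q := by positivity
  have h2 : 0 ≤ (2 * C₁) ^ Q := by positivity
  rcases le_total z 1 with h | h
  · have h3 : (C₁ * (1 + z)) ^ q ≤ (2 * C₁) ^ q :=
      Real.rpow_le_rpow (by positivity) (by nlinarith) hq
    have h4 : (2 * C₁) ^ q ≤ (2 * C₁) ^ Q := Real.rpow_le_rpow_of_exponent_le (by linarith) hqQ
    linarith
  · have h3 : (C₁ * (1 + z)) ^ q ≤ (2 * C₁ * z) ^ q :=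
      Real.rpow_le_rpow (by positivity) (by nlinarith) hq
    linarith

/-- The interpolation `f + χ (u - f)` between `u` and `f`. -/
def blend (χ u f : Euc N → ℝ) (x : Euc N) : ℝ := f x + χ x * (u x - f x)

lemma norm_gradient_blend_le {χ u f : Euc N → ℝ} {x : Euc N} (hχ : DifferentiableAt ℝ χ x)
    (hu : DifferentiableAt ℝ u x) (hf : DifferentiableAt ℝ f x) {Kχ Kf M : ℝ} (hM : |u x - f x| ≤ M)
    (hχ1 : |χ x| ≤ 1) (hKχ : ‖fderiv ℝ χ x‖ ≤ Kχ) (hKf : ‖fderiv ℝ f x‖ ≤ Kf) :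
    ‖gradient (blend χ u f) x‖ ≤ (1 + 2 * Kf + M * Kχ) * (1 + ‖gradient u x‖) := by
  have h1 : HasFDerivAt (blend χ u f) (fderiv ℝ f x + (χ x • (fderiv ℝ u x - fderiv ℝ f x) +
      (u x - f x) • fderiv ℝ χ x)) x :=
    hf.hasFDerivAt.add (hχ.hasFDerivAt.mul (hu.hasFDerivAt.sub hf.hasFDerivAt))
  rw [norm_gradient, norm_gradient, h1.fderiv]
  have hM0 := (abs_nonneg _).trans hM
  have hKf0 := (norm_nonneg _).trans hKf
  have hKχ0 := (norm_nonneg _).trans hKχ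
  calc _ ≤ ‖fderiv ℝ f x‖ + (‖χ x • (fderiv ℝ u x - fderiv ℝ f x)‖ +
      ‖(u x - f x) • fderiv ℝ χ x‖) :=
        (norm_add_le _ _).trans (add_le_add_right (norm_add_le _ _) _)
    _ ≤ Kf + (1 * (‖fderiv ℝ u x‖ + Kf) + M * Kχ) := by
      rw [norm_smul, norm_smul, Real.norm_eq_abs, Real.norm_eq_abs]
      gcongr
      exact (norm_sub_le _ _).trans (add_le_add_right hKf _)
    _ ≤ _ := by nlinarith [norm_nonneg (fderiv ℝ u x), mul_nonneg hKf0 (norm_nonneg (fderiv ℝ u x)),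
        mul_nonneg (mul_nonneg hM0 hKχ0) (norm_nonneg (fderiv ℝ u x))]

/-- The gap between Sobolev and smooth competitors, from a pair of functions `u`, `v` that are
smooth away from `{δ = 0}`, whose gradients live where `b < 0` and `b > 0` respectively, and whose
singularities are governed by the conjugate exponents `p₀` and `p₀ / (p₀ - 1)`. -/
theorem exists_gap {pm pp p₀ : ℝ} (hpm : 1 < pm) (hp₀ : pm < p₀) (hpp : p₀ < pp) (hN : 0 < N)
    {δ u v b f η : Euc N → ℝ} {su sv m Δ Cν L Kf Mf : ℝ} (hm : 1 < m)
    (hδ : Continuous δ) (hδ0 : ∀ x, 0 ≤ δ x) (hΔ : ∀ x ∈ Omg N, δ x ≤ Δ)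
    (hν : ∀ r, 0 < r → r ≤ 1 →
      volume.restrict (Omg N) {x | δ x < r} ≤ ENNReal.ofReal (Cν * r ^ m))
    (hsu : 0 < su) (hsu1 : su ≤ 1) (hsum : su * p₀ = m) (hu : RegAway δ su u)
    (hsv : 0 < sv) (hsv1 : sv ≤ 1) (hsvm : sv * (p₀ / (p₀ - 1)) = m) (hv : RegAway δ sv v)
    (hL : 1 ≤ L) (hb : ∀ x y, |b x - b y| ≤ L * ‖x - y‖)
    (hf : ContDiff ℝ (⊤ : ℕ∞) f) (hfM : ∀ x, |f x| ≤ Mf) (hfL : ∀ x y, |f x - f y| ≤ Kf * ‖x - y‖)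
    (hη : ContDiff ℝ (⊤ : ℕ∞) η) (hη0 : ∀ x, 0 ≤ η x) (hη1 : ∀ x, η x ≤ 1) {i j : Fin N}
    (hi : ∀ x, fderiv ℝ η x (EuclideanSpace.single i 1) = 0)
    (hj : ∀ x, fderiv ℝ η x (EuclideanSpace.single j 1) = 0)
    (hc : ∫ x in Omg N, (gradient v x j * (η x * gradient f x i) -
      gradient v x i * (η x * gradient f x j)) ≠ 0)
    (hbv : ∀ x, 0 < δ x → η x ≠ 0 → gradient v x ≠ 0 → δ x / 4 ≤ b x)
    (hbu : ∀ x, 0 < δ x → gradient u x ≠ 0 → b x ≤ -(δ x / 4))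
    (haway : ∀ x, 0 < δ x → 3 / 4 * √N ≤ ‖x‖ → 0 ≤ b x → u =ᶠ[𝓝 x] f) :
    ∃ (ϰ₀ : ℝ) (p : Euc N → ℝ) (ubd : Euc N → ℝ) (t₀ : ℝ),
      0 < ϰ₀ ∧
      Continuous p ∧ (∀ x, p x ∈ Set.Icc pm pp) ∧
      (∀ x y : Euc N, 0 < dist x y → dist x y ≤ Real.exp (-Real.exp 1) →
        |p x - p y| ≤ ϰ₀ * (Real.log (1 / dist x y))⁻¹ * Real.log (Real.log (1 / dist x y))) ∧
      ContDiff ℝ (⊤ : ℕ∞) ubd ∧ 0 < t₀ ∧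
      ∀ t : ℝ, t₀ ≤ t →
        ∃ (w : Euc N → ℝ) (g : Euc N → Euc N),
          HasWeakGradOn N w g ∧
          (∃ M : ℝ, ∀ x, |w x - t * ubd x| ≤ M) ∧
          HasCompactSupport (fun x => w x - t * ubd x) ∧
          tsupport (fun x => w x - t * ubd x) ⊆ Omg N ∧
          (∫⁻ x in Omg N, ENNReal.ofReal (‖g x‖ ^ p x)) < ⊤ ∧
          (∫⁻ x in Omg N, ENNReal.ofReal (‖g x‖ ^ p x)) <
            sInf { r : ℝ≥0∞ | ∃ φ : Euc N → ℝ, IsTestFun N φ ∧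
              r = ∫⁻ x in Omg N, ENNReal.ofReal
                    (‖t • gradient ubd x + gradient φ x‖ ^ p x) } := by
  have hp₀1 : 1 < p₀ := hpm.trans hp₀
  have hpos : ∀ᵐ x ∂volume.restrict (Omg N), 0 < δ x := ae_pos_of_measure_lt (by linarith) hν
  have hint : Integrable (fun x => (δ x)⁻¹) (volume.restrict (Omg N)) :=
    integrable_inv_of_measure_lt hδ.measurable hm hδ0 hν
  set c : ℝ := 1 / ((pp - 1) * (p₀ - 1))
  have hcpos : 0 < c := one_div_pos.2 (mul_pos (by linarith) (by linarith))
  set k := 2 / su + 2 / (sv * c)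
  have hk : 0 < k := by positivity
  have hku : 2 ≤ su * k := by
    have : su * k = 2 + 2 * su / (sv * c) := by simp only [k]; field_simp
    rw [this]; have : 0 ≤ 2 * su / (sv * c) := by positivity
    linarith
  have hkv : 2 ≤ sv * (c * k) := by
    have : sv * (c * k) = 2 + 2 * (sv * c) / su := by simp only [k]; field_simp; ring
    rw [this]; have : 0 ≤ 2 * (sv * c) / su := by positivity
    linarith
  set e := min (p₀ - pm) (pp - p₀)
  have he : 0 < e := lt_min (by linarith) (by linarith)
  set p : Euc N → ℝ := fun x => p₀ + oddEll k e (b x)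
  have hbc : Continuous b := (lipschitz_of_abs_sub_le hb).continuous
  have hpc : Continuous p := continuous_const.add ((continuous_oddEll hk.le).comp hbc)
  have hpI : ∀ x, p x ∈ Set.Icc pm pp := fun x => by
    have h1 := abs_le.1 (abs_oddEll_le hk.le he.le (b x))
    have h2 : e ≤ p₀ - pm := min_le_left _ _
    have h3 : e ≤ pp - p₀ := min_le_right _ _
    exact ⟨by simp only [p]; linarith [h1.1], by simp only [p]; linarith [h1.2]⟩
  have hp1 : ∀ x, 1 < p x := fun x => hpm.trans_le (hpI x).1
  have hpmod : ∀ x y : Euc N, 0 < dist x y → dist x y ≤ Real.exp (-Real.exp 1) →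
      |p x - p y| ≤ 2 * k * L * (log (1 / dist x y))⁻¹ * log (log (1 / dist x y)) := by
    intro x y h0 h1
    rw [mul_assoc, ← lam_eq h0 h1]
    have h2 : p x - p y = oddEll k e (b x) - oddEll k e (b y) := by simp only [p]; ring
    rw [h2]
    calc _ ≤ 2 * k * lam |b x - b y| := oddEll_sub_le hk.le _ _
      _ ≤ 2 * k * lam (L * dist x y) := by
        gcongr
        exact lam_mono (by rw [dist_eq_norm]; exact hb x y)
      _ ≤ 2 * k * (L * lam (dist x y)) := by gcongr; exact lam_scale hL
      _ = _ := by ring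
  have hpge : ∀ x, 0 < δ x → δ x / 4 ≤ b x → p₀ + ell k e (δ x / 4) ≤ p x := by
    intro x hx h
    simp only [p]
    rw [oddEll_of_nonneg he.le (by linarith)]
    linarith [ell_mono (e := e) hk.le h]
  have hple : ∀ x, 0 < δ x → b x ≤ -(δ x / 4) → p x ≤ p₀ - ell k e (δ x / 4) := by
    intro x hx h
    simp only [p]
    rw [oddEll_of_nonpos he.le (by linarith)]
    linarith [ell_mono (e := e) hk.le (show δ x / 4 ≤ -b x by linarith)]
  -- the competitor
  have hN' : 0 < √(N : ℝ) := Real.sqrt_pos.2 (by exact_mod_cast hN)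
  let χ : ContDiffBump (0 : Euc N) := ⟨3 / 4 * √N, 7 / 8 * √N, by positivity, by linarith⟩
  have hχc : ContDiff ℝ (⊤ : ℕ∞) (χ : Euc N → ℝ) := χ.contDiff
  obtain ⟨Kχ, hKχ⟩ := ContDiff.lipschitzWith_of_hasCompactSupport χ.hasCompactSupport hχc (by simp)
  have hχ1 : ∀ x, |χ x| ≤ 1 := fun x => by rw [abs_of_nonneg χ.nonneg]; exact χ.le_one
  have hwreg : RegAway δ su (blend χ u f) := hu.cutoff hsu.le hfL hfM
    (fun x y => by simpa [dist_eq_norm] using hKχ.dist_le_mul x y) hχ1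
  have hwgrad : HasWeakGradOn N (blend χ u f) (gradient (blend χ u f)) :=
    hwreg.hasWeakGradOn hδ hsu.le hsu1 hpos hint
  obtain ⟨Mu, hMu⟩ : ∃ Mu, ∀ x, |u x| ≤ Mu := by
    obtain ⟨_, M, _, _, h, _⟩ := hu; exact ⟨M, h⟩
  have hKf : ∀ x, ‖fderiv ℝ f x‖ ≤ |Kf| := fun x => by
    have := norm_fderiv_le_of_lipschitz ℝ (lipschitz_of_abs_sub_le (K := |Kf|) fun x y =>
      (hfL x y).trans (by gcongr; exact le_abs_self _)) (x₀ := x)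
    rwa [Real.coe_toNNReal _ (abs_nonneg _)] at this
  have hufM : ∀ x, |u x - f x| ≤ Mu + Mf := fun x =>
    (abs_sub _ _).trans (add_le_add (hMu x) (hfM x))
  have hMuf : 0 ≤ Mu + Mf := (abs_nonneg _).trans (hufM 0)
  set C₁ := 1 + 2 * |Kf| + (Mu + Mf) * Kχ
  have hC₁ : 1 ≤ C₁ := by
    have : 0 ≤ (Mu + Mf) * Kχ := by positivity
    have := abs_nonneg Kf
    simp only [C₁]; linarith
  have hwbound : ∀ᵐ x ∂volume.restrict (Omg N),
      ‖gradient (blend χ u f) x‖ ≤ C₁ * (1 + ‖gradient u x‖) := by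
    filter_upwards [hu.ae_differentiableAt hδ hpos] with x hx
    exact norm_gradient_blend_le (hχc.differentiable (by simp) x) hx
      (hf.differentiable (by simp) x) (hufM x) (hχ1 x) (norm_fderiv_le_of_lipschitz ℝ hKχ) (hKf x)
  have hwlt : ∀ᵐ x ∂volume.restrict (Omg N), gradient (blend χ u f) x ≠ 0 → p x < p₀ := by
    filter_upwards [hpos] with x hx
    contrapose!
    intro hpx
    have hbx : 0 ≤ b x := by
      by_contra! h
      simp only [p] at hpx
      rw [oddEll_of_nonpos he.le h.le] at hpx
      linarith [ell_pos hk he (show 0 < -b x by linarith)]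
    have hgu : gradient u x = 0 := by
      by_contra h
      linarith [hbu x hx h]
    have hw : blend χ u f =ᶠ[𝓝 x] u := by
      rcases lt_or_ge ‖x‖ (3 / 4 * √N) with h | h
      · have : (χ : Euc N → ℝ) =ᶠ[𝓝 x] 1 := χ.eventuallyEq_one_of_mem_ball (by simpa using h)
        filter_upwards [this] with y hy
        simp [blend, hy]
      · filter_upwards [haway x hx h hbx] with y hy
        simp [blend, hy]
    rw [hw.gradient.eq_of_nhds, hgu]
  have hufin : ∫⁻ x in Omg N, ENNReal.ofReal (‖(2 * C₁) • gradient u x‖ ^ p x) < ⊤ := by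
    obtain ⟨C, hC, hCu⟩ := hu.norm_fderiv_le hδ hsu.le
    refine lintegral_rpow_lt_top (s := su) (q₀ := p₀) (C := 2 * C₁ * C) hδ hpos hΔ hsu
        (by linarith) hku he
      (by rwa [hsum]) (fun x => by linarith [hp1 x]) (by positivity) (fun x hx => ?_) ?_
    · rw [norm_smul, Real.norm_of_nonneg (by positivity), norm_gradient, mul_assoc (2 * C₁)]
      exact mul_le_mul_of_nonneg_left (hCu x hx) (by positivity)
    · filter_upwards [hpos] with x hx h
      exact hple x hx (hbu x hx fun h0 => h (by rw [h0, smul_zero]))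
  have hwfin : ∫⁻ x in Omg N, ENNReal.ofReal (‖gradient (blend χ u f) x‖ ^ p x) < ⊤ := by
    have h1 : ∫⁻ x in Omg N, (ENNReal.ofReal ((2 * C₁) ^ pp) +
        ENNReal.ofReal (‖(2 * C₁) • gradient u x‖ ^ p x)) < ⊤ := by
      rw [lintegral_add_left measurable_const, lintegral_const]
      exact ENNReal.add_lt_top.2
        ⟨ENNReal.mul_lt_top ENNReal.ofReal_lt_top (measure_lt_top _ _), hufin⟩
    refine lt_of_le_of_lt (lintegral_mono_ae ?_) h1
    filter_upwards [hwbound] with x hx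
    have hp0 : 0 ≤ p x := by linarith [hp1 x]
    rw [← ENNReal.ofReal_add (by positivity) (by positivity)]
    apply ENNReal.ofReal_le_ofReal
    rw [norm_smul, Real.norm_of_nonneg (by positivity)]
    exact (Real.rpow_le_rpow (norm_nonneg _) hx hp0).trans
      (rpow_add_le_add (norm_nonneg _) hC₁ hp0 (hpI x).2)
  -- the smooth competitors
  have hvfin : ∫⁻ x in Omg N,
      ENNReal.ofReal ((2 * η x * ‖gradient v x‖) ^ (p x / (p x - 1))) < ⊤ := by
    obtain ⟨C, hC, hCv⟩ := hv.norm_fderiv_le hδ hsv.le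
    have hq₀ : 0 < p₀ / (p₀ - 1) := div_pos (by linarith) (by linarith)
    have h1 := lintegral_rpow_lt_top (s := sv) (q₀ := p₀ / (p₀ - 1)) (C := 2 * C) (k := c * k)
      (e := c * e) (q := fun x => p x / (p x - 1)) (g := fun x => (2 * η x) • gradient v x)
      hδ hpos hΔ hsv hq₀ hkv (mul_pos hcpos he) (by rwa [hsvm])
      (fun x => div_nonneg (by linarith [hp1 x]) (by linarith [hp1 x])) (by positivity)
      (fun x hx => ?_) ?_
    · refine lt_of_eq_of_lt ?_ h1
      congr 1
      ext x
      rw [norm_smul, Real.norm_of_nonneg (by linarith [hη0 x])]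
    · rw [norm_smul, Real.norm_of_nonneg (by linarith [hη0 x]), norm_gradient, mul_assoc, mul_assoc]
      have h2 := hCv x hx
      have h3 : 0 ≤ ‖fderiv ℝ v x‖ := norm_nonneg _
      nlinarith [hη0 x, hη1 x, mul_le_mul_of_nonneg_right (hη1 x) h3]
    · filter_upwards [hpos] with x hx h
      have h2 : η x ≠ 0 := fun h0 => h (by rw [h0]; simp)
      have h3 : gradient v x ≠ 0 := fun h0 => h (by rw [h0]; simp)
      have h4 := hpge x hx (hbv x hx h2 h3)
      have h5 := ell_mul (k := k) (e := e) hcpos.le (δ x / 4)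
      have h6 : 0 ≤ ell k e (δ x / 4) := ell_nonneg hk.le he.le _
      have h7 := (hpI x).2
      have h8 := hp1 x
      have h9 : p₀ / (p₀ - 1) - p x / (p x - 1) = (p x - p₀) / ((p x - 1) * (p₀ - 1)) := by
        field_simp [show p₀ - 1 ≠ 0 by linarith, show p x - 1 ≠ 0 by linarith]
        ring
      have h10 : c * ell k e (δ x / 4) ≤ (p x - p₀) / ((p x - 1) * (p₀ - 1)) := by
        rw [div_eq_mul_one_div (p x - p₀), mul_comm (p x - p₀)]
        refine mul_le_mul (one_div_le_one_div_of_le (mul_pos (by linarith) (by linarith)) ?_)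
          (by linarith) h6 (one_div_nonneg.2 (mul_nonneg (by linarith) (by linarith)))
        exact mul_le_mul_of_nonneg_right (by linarith) (by linarith)
      rw [h5]
      linarith
  obtain ⟨c₁, hc₁, t₁, ht₁⟩ := energy_lower hp₀1 hpc.measurable hp1
    (hv.hasWeakGradOn hδ hsv.le hsv1 hpos hint) (measurable_gradient v) hη hη0 hη1 hi hj
    (fun x => (norm_gradient f x).trans_le (hKf x)) hc (by
      filter_upwards [hpos] with x hx h2 h3
      linarith [hpge x hx (hbv x hx h2 h3), ell_nonneg hk.le he.le (δ x / 4)]) hvfin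
  obtain ⟨t₂, ht₂⟩ := energy_upper hpc.measurable (measurable_gradient (blend χ u f))
    (fun x => by linarith [hp1 x]) hwlt hwfin hc₁
  refine ⟨2 * k * L, p, f, max 1 (max t₁ t₂), by positivity, hpc, hpI, hpmod, hf,
    lt_max_of_lt_left one_pos, fun t ht => ?_⟩
  have ht0 : 1 ≤ t := (le_max_left _ _).trans ht
  have h2 := ht₂ t ((le_max_right _ _).trans ((le_max_right _ _).trans ht))
  have hdiff : ∀ x, t * blend χ u f x - t * f x = χ x * (t * (u x - f x)) := fun x => by
    rw [blend]; ring
  have hsupp : tsupport (fun x => t * blend χ u f x - t * f x) ⊆ tsupport χ := by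
    simp only [hdiff]
    exact tsupport_mul_subset_left (f := (χ : Euc N → ℝ)) (g := fun x => t * (u x - f x))
  refine ⟨fun x => t * blend χ u f x, fun x => t • gradient (blend χ u f) x, hwgrad.const_smul t,
    ⟨t * (Mu + Mf), fun x => ?_⟩, ?_, hsupp.trans ?_, h2.trans ENNReal.ofReal_lt_top,
    h2.trans_le (le_sInf ?_)⟩
  · rw [hdiff, abs_mul, abs_mul, abs_of_nonneg (show 0 ≤ t by linarith)]
    calc _ ≤ 1 * (t * (Mu + Mf)) := by gcongr; exacts [hχ1 x, hufM x]
      _ = _ := one_mul _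
  · exact χ.hasCompactSupport.of_isClosed_subset (isClosed_tsupport _) hsupp
  · rw [χ.tsupport_eq, Omg]
    exact Metric.closedBall_subset_ball (show 7 / 8 * √(N : ℝ) < √N by linarith)
  · rintro r ⟨φ, hφ, rfl⟩
    exact ht₁ t ((le_max_left _ _).trans ((le_max_right _ _).trans ht)) φ hφ

end

section ramp

/-- The piecewise linear function of `y` rising from `0` to `1` on `[-ρ/4, ρ/4]`. -/
def ramp (ρ y : ℝ) : ℝ := 1 / 2 + 2 * max (-(ρ / 4)) (min (ρ / 4) y) / ρ

lemma abs_clip_le {ρ y : ℝ} (hρ : 0 ≤ ρ) : |max (-(ρ / 4)) (min (ρ / 4) y)| ≤ ρ / 4 :=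
  abs_le.2 ⟨le_max_left _ _, max_le (by linarith) (min_le_left _ _)⟩

lemma abs_ramp_le {ρ y : ℝ} (hρ : 0 ≤ ρ) : |ramp ρ y| ≤ 1 := by
  rcases hρ.eq_or_lt with rfl | h
  · rw [ramp, div_zero]; norm_num
  have h1 : |2 * max (-(ρ / 4)) (min (ρ / 4) y) / ρ| ≤ 1 / 2 := by
    rw [abs_div, abs_mul, abs_of_pos h, div_le_iff₀ h, abs_two]
    linarith [abs_clip_le hρ (y := y)]
  rw [ramp]
  have := abs_le.1 h1
  exact abs_le.2 ⟨by linarith [this.1], by linarith [this.2]⟩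

lemma ramp_of_ge {ρ y : ℝ} (hρ : 0 < ρ) (h : ρ / 4 ≤ y) : ramp ρ y = 1 := by
  rw [ramp, min_eq_left h, max_eq_right (by linarith)]
  field_simp
  norm_num

lemma ramp_of_le {ρ y : ℝ} (hρ : 0 < ρ) (h : y ≤ -(ρ / 4)) : ramp ρ y = 0 := by
  rw [ramp, min_eq_right (by linarith), max_eq_left h]
  field_simp
  norm_num

lemma ramp_of_abs_le {ρ y : ℝ} (h : |y| ≤ ρ / 4) : ramp ρ y = 1 / 2 + 2 * y / ρ := by
  have := abs_le.1 h
  rw [ramp, min_eq_right this.2, max_eq_right this.1]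

lemma ramp_mono {ρ : ℝ} (hρ : 0 ≤ ρ) : Monotone (ramp ρ) := fun y y' h => by
  unfold ramp
  gcongr

lemma ramp_max_abs {ρ y : ℝ} (hρ : 0 < ρ) : ramp (max |y| ρ) y = ramp ρ y := by
  rcases le_total |y| ρ with h | h
  · rw [max_eq_right h]
  · rw [max_eq_left h]
    have h0 : 0 < |y| := hρ.trans_le h
    rcases abs_cases y with ⟨h1, h2⟩ | ⟨h1, h2⟩
    · rw [ramp_of_ge h0 (by linarith), ramp_of_ge hρ (by linarith)]
    · rw [ramp_of_le h0 (by linarith), ramp_of_le hρ (by linarith)]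

lemma abs_ramp_sub_le {ε ρ ρ' y y' : ℝ} (hε : 0 < ε) (hρ : ε ≤ ρ) (hρ' : ε ≤ ρ') :
    |ramp ρ y - ramp ρ' y'| ≤ ε⁻¹ * (|ρ - ρ'| + 2 * |y - y'|) := by
  have h0 : 0 < ρ := hε.trans_le hρ
  have h0' : 0 < ρ' := hε.trans_le hρ'
  set c := max (-(ρ / 4)) (min (ρ / 4) y) with hc
  set c' := max (-(ρ' / 4)) (min (ρ' / 4) y') with hc'
  have h1 : |c - c'| ≤ |ρ - ρ'| / 4 + |y - y'| := by
    have e1 := abs_max_sub_max_le_max (-(ρ / 4)) (min (ρ / 4) y) (-(ρ' / 4)) (min (ρ' / 4) y')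
    have e2 := abs_min_sub_min_le_max (ρ / 4) y (ρ' / 4) y'
    have e3 : |-(ρ / 4) - -(ρ' / 4)| = |ρ - ρ'| / 4 := by
      rw [show -(ρ / 4) - -(ρ' / 4) = -((ρ - ρ') / 4) by ring, abs_neg, abs_div]; norm_num
    have e4 : |ρ / 4 - ρ' / 4| = |ρ - ρ'| / 4 := by
      rw [show ρ / 4 - ρ' / 4 = (ρ - ρ') / 4 by ring, abs_div]; norm_num
    rw [e3] at e1
    rw [e4] at e2
    have := abs_nonneg (ρ - ρ')
    have := abs_nonneg (y - y')
    refine e1.trans (max_le (by linarith) (e2.trans (max_le (by linarith) (by linarith))))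
  have h2 : |c'| ≤ ρ' / 4 := abs_clip_le h0'.le
  have e : ramp ρ y - ramp ρ' y' = ρ⁻¹ * (2 * (c - c') + 2 * (c' / ρ') * (ρ' - ρ)) := by
    rw [ramp, ramp, ← hc, ← hc']
    field_simp
    ring
  have h3 : |c' / ρ'| ≤ 1 / 4 := by
    rw [abs_div, abs_of_pos h0', div_le_iff₀ h0']; linarith
  rw [e, abs_mul, abs_of_pos (inv_pos.2 h0)]
  refine mul_le_mul (inv_anti₀ hε hρ) ?_ (abs_nonneg _) (inv_pos.2 hε).le
  refine (abs_add_le _ _).trans ?_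
  rw [abs_mul, abs_mul, abs_mul, abs_two, abs_sub_comm ρ' ρ]
  nlinarith [abs_nonneg (ρ - ρ'), abs_nonneg (c' / ρ')]

end ramp

section avg

/-- The average of `F` over the interval of radius `r` around `x`. -/
def avg (F : ℝ → ℝ) (x r : ℝ) : ℝ := ∫ s in (0 : ℝ)..1, F (x + r * (2 * s - 1))

variable {F : ℝ → ℝ}

lemma abs_two_mul_sub_one_le {s : ℝ} (h : s ∈ Set.uIcc (0 : ℝ) 1) : |2 * s - 1| ≤ 1 := by
  rw [Set.uIcc_of_le zero_le_one] at h
  exact abs_le.2 ⟨by linarith [h.1], by linarith [h.2]⟩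

lemma avg_eq_of_forall {x r c : ℝ} (h : ∀ z, |z - x| ≤ |r| → F z = c) : avg F x r = c := by
  have : avg F x r = ∫ s in (0 : ℝ)..1, c := by
    refine intervalIntegral.integral_congr fun s hs => h _ ?_
    rw [add_sub_cancel_left, abs_mul]
    exact mul_le_of_le_one_right (abs_nonneg _) (abs_two_mul_sub_one_le hs)
  simpa using this

lemma continuous_avg_integrand (hF : Continuous F) (x r : ℝ) :
    Continuous fun s : ℝ => F (x + r * (2 * s - 1)) := by fun_prop

lemma avg_mono (hF : Continuous F) (hm : Monotone F) (r : ℝ) : Monotone fun x => avg F x r :=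
  fun x x' h => intervalIntegral.integral_mono_on zero_le_one
    ((continuous_avg_integrand hF x r).intervalIntegrable _ _)
    ((continuous_avg_integrand hF x' r).intervalIntegrable _ _) fun s _ => hm (by linarith)

lemma abs_avg_le {M : ℝ} (hM : ∀ x, |F x| ≤ M) (x r : ℝ) : |avg F x r| ≤ M := by
  have := intervalIntegral.norm_integral_le_of_norm_le_const (a := 0) (b := 1)
    (f := fun s => F (x + r * (2 * s - 1))) (C := M) fun s _ => hM _
  simpa [avg] using this

lemma two_mul_avg (x r : ℝ) : 2 * r * avg F x r = ∫ z in (x - r)..(x + r), F z := by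
  have := intervalIntegral.mul_integral_comp_add_mul (f := F) (a := 0) (b := 1) (2 * r) (x - r)
  rw [avg]
  rw [show x - r + 2 * r * 0 = x - r by ring, show x - r + 2 * r * 1 = x + r by ring] at this
  rw [← this]
  congr 2
  ext s
  congr 1
  ring

lemma hasDerivAt_avg (hF : Continuous F) (x : ℝ) {r : ℝ} (hr : 0 < r) :
    HasDerivAt (fun x => avg F x r) ((F (x + r) - F (x - r)) / (2 * r)) x := by
  have h1 : (fun x => avg F x r) =
      fun x => ((∫ z in (0 : ℝ)..(x + r), F z) - ∫ z in (0 : ℝ)..(x - r), F z) / (2 * r) := by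
    ext x
    rw [intervalIntegral.integral_interval_sub_left (hF.intervalIntegrable _ _)
      (hF.intervalIntegrable _ _), ← two_mul_avg]
    field_simp
  have h2 : ∀ b, HasDerivAt (fun b => ∫ z in (0 : ℝ)..b, F z) (F b) b := fun b =>
    intervalIntegral.integral_hasDerivAt_right (hF.intervalIntegrable _ _)
      hF.stronglyMeasurable.stronglyMeasurableAtFilter hF.continuousAt
  rw [h1]
  have h3 : HasDerivAt (fun x => ∫ z in (0 : ℝ)..(x + r), F z) (F (x + r)) x :=
    HasDerivAt.comp_add_const x r (h2 (x + r))
  have h4 : HasDerivAt (fun x => ∫ z in (0 : ℝ)..(x - r), F z) (F (x - r)) x :=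
    HasDerivAt.comp_sub_const x r (h2 (x - r))
  exact (h3.sub h4).div_const _

lemma abs_avg_sub_le_holder (hF : Continuous F) {K D : ℝ} (hK : 0 ≤ K) (hD : 0 ≤ D)
    (hH : ∀ x y, |F x - F y| ≤ K * |x - y| ^ D) (x x' r r' : ℝ) :
    |avg F x r - avg F x' r'| ≤ K * (|x - x'| + |r - r'|) ^ D := by
  rw [avg, avg, ← intervalIntegral.integral_sub
    ((continuous_avg_integrand hF x r).intervalIntegrable _ _)
    ((continuous_avg_integrand hF x' r').intervalIntegrable _ _)]
  have := intervalIntegral.norm_integral_le_of_norm_le_const (a := 0) (b := 1)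
    (f := fun s => F (x + r * (2 * s - 1)) - F (x' + r' * (2 * s - 1)))
    (C := K * (|x - x'| + |r - r'|) ^ D) fun s hs => ?_
  · simpa using this
  · refine (hH _ _).trans ?_
    gcongr
    have e : x + r * (2 * s - 1) - (x' + r' * (2 * s - 1)) = (x - x') + (r - r') * (2 * s - 1) := by
      ring
    rw [e]
    refine (abs_add_le _ _).trans ?_
    rw [abs_mul]
    gcongr
    exact mul_le_of_le_one_right (abs_nonneg _) (abs_two_mul_sub_one_le (Set.uIoc_subset_uIcc hs))

/-- Averages at scale at least `ε` of a `D`-Hölder function are Lipschitz with constant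
`O(ε ^ (D - 1))`. -/
lemma abs_avg_sub_le (hF : Continuous F) {K D ε x x' r r' : ℝ} (hK : 0 ≤ K) (hD : 0 ≤ D)
    (hD1 : D ≤ 1)
    (hH : ∀ x y, |F x - F y| ≤ K * |x - y| ^ D) (hε : 0 < ε) (hr : ε ≤ r) (hr' : ε ≤ r') :
    |avg F x r - avg F x' r'| ≤ 4 * K * ε ^ (-(1 - D)) * (|x - x'| + |r - r'|) := by
  set h := |x - x'| + |r - r'| with hh
  have hr0 : 0 < r := hε.trans_le hr
  have hr0' : 0 < r' := hε.trans_le hr'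
  have hh0 : 0 ≤ h := by positivity
  have hdiv : ∀ z : ℝ, 0 < z → z ^ D = z ^ (-(1 - D)) * z := fun z hz => by
    rw [← Real.rpow_add_one hz.ne']; congr 1; ring
  rcases le_or_gt r h with hle | hlt
  · have hhp : 0 < h := hr0.trans_le hle
    refine (abs_avg_sub_le_holder hF hK hD hH x x' r r').trans ?_
    rw [← hh, hdiv h hhp]
    have h1 : h ^ (-(1 - D)) ≤ ε ^ (-(1 - D)) :=
      Real.rpow_le_rpow_of_nonpos hε (hr.trans hle) (by linarith)
    have h2 : 0 ≤ ε ^ (-(1 - D)) := by positivity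
    calc K * (h ^ (-(1 - D)) * h) ≤ K * (ε ^ (-(1 - D)) * h) := by gcongr
      _ ≤ 4 * (K * (ε ^ (-(1 - D)) * h)) := by
        have : 0 ≤ K * (ε ^ (-(1 - D)) * h) := by positivity
        linarith
      _ = _ := by ring
  · set G : ℝ → ℝ := fun z => F z - F x with hG
    have hGc : Continuous G := hF.sub continuous_const
    have hGavg : ∀ z t, avg G z t = avg F z t - F x := by
      intro z t
      rw [avg, avg, intervalIntegral.integral_sub
        ((continuous_avg_integrand hF z t).intervalIntegrable _ _)
        (intervalIntegrable_const)]
      simp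
    have hab := abs_le.1 (le_refl |x - x'|)
    have hrr := abs_le.1 (le_refl |r - r'|)
    have hGb : ∀ z, |z - x| ≤ 2 * r → |G z| ≤ K * (2 * r) ^ D := fun z hz =>
      (hH z x).trans (by gcongr)
    have hI : ∀ a b, |a - x| ≤ 2 * r → |b - x| ≤ 2 * r → |a - b| ≤ h →
        |∫ z in a..b, G z| ≤ K * (2 * r) ^ D * h := by
      intro a b ha hb hab
      have := intervalIntegral.norm_integral_le_of_norm_le_const (a := a) (b := b) (f := G)
        (C := K * (2 * r) ^ D) fun z hz => hGb z ?_
      · refine this.trans ?_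
        rw [abs_sub_comm]
        gcongr
      · have h1 := abs_le.1 ha
        have h2 := abs_le.1 hb
        have h3 := Set.uIoc_subset_uIcc hz
        rw [Set.mem_uIcc] at h3
        rcases h3 with h3 | h3 <;> exact abs_le.2 ⟨by linarith, by linarith⟩
    have hii : ∀ a b, IntervalIntegrable G volume a b := fun a b => hGc.intervalIntegrable a b
    have hdiff : 2 * r * avg G x r - 2 * r' * avg G x' r' =
        (∫ z in (x' + r')..(x + r), G z) - ∫ z in (x' - r')..(x - r), G z := by
      have a1 := intervalIntegral.integral_add_adjacent_intervals (hii (x' - r') (x' + r'))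
        (hii (x' + r') (x + r))
      have a2 := intervalIntegral.integral_add_adjacent_intervals (hii (x' - r') (x - r))
        (hii (x - r) (x + r))
      rw [two_mul_avg, two_mul_avg]
      linarith
    have h1 : |2 * r * avg G x r - 2 * r' * avg G x' r'| ≤ 2 * (K * (2 * r) ^ D * h) := by
      rw [hdiff, two_mul]
      refine (abs_sub _ _).trans (add_le_add (hI _ _ ?_ ?_ ?_) (hI _ _ ?_ ?_ ?_)) <;>
        exact abs_le.2 ⟨by linarith, by linarith⟩
    have h2 : |avg G x' r'| ≤ K * (2 * r) ^ D := by
      have := intervalIntegral.norm_integral_le_of_norm_le_const (a := 0) (b := 1)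
        (f := fun s => G (x' + r' * (2 * s - 1))) (C := K * (2 * r) ^ D) fun s hs => hGb _ ?_
      · simpa [avg] using this
      · have e : x' + r' * (2 * s - 1) - x = (x' - x) + r' * (2 * s - 1) := by ring
        rw [e]
        refine (abs_add_le _ _).trans ?_
        rw [abs_mul, abs_of_pos hr0', abs_sub_comm x' x]
        have := mul_le_of_le_one_right hr0'.le (abs_two_mul_sub_one_le (Set.uIoc_subset_uIcc hs))
        linarith
    have e : avg F x r - avg F x' r' = (2 * r)⁻¹ * ((2 * r * avg G x r - 2 * r' * avg G x' r') +
        2 * (r' - r) * avg G x' r') := by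
      have : avg F x r - avg F x' r' = avg G x r - avg G x' r' := by rw [hGavg, hGavg]; ring
      rw [this]
      field_simp
      ring
    have h2r : 0 < 2 * r := by linarith
    have h3 : (2 * r) ^ (-(1 - D)) ≤ ε ^ (-(1 - D)) :=
      Real.rpow_le_rpow_of_nonpos hε (by linarith) (by linarith)
    rw [e, abs_mul, abs_of_pos (inv_pos.2 h2r)]
    have h4 : |(2 * r * avg G x r - 2 * r' * avg G x' r') + 2 * (r' - r) * avg G x' r'| ≤
        4 * (K * (2 * r) ^ D * h) := by
      refine (abs_add_le _ _).trans ?_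
      rw [abs_mul (2 * (r' - r)), abs_mul, abs_two, abs_sub_comm r' r]
      have : 2 * |r - r'| * |avg G x' r'| ≤ 2 * h * (K * (2 * r) ^ D) := by
        gcongr
        linarith [abs_nonneg (x - x')]
      linarith
    calc _ ≤ (2 * r)⁻¹ * (4 * (K * (2 * r) ^ D * h)) := by gcongr
      _ = 4 * K * (2 * r) ^ (-(1 - D)) * h := by
        rw [hdiv _ h2r]; field_simp
      _ ≤ _ := by gcongr

end avg

section fracDist

variable {n : ℕ} {d : ℝ → ℝ}

/-- Distance-like function to the set `{d = 0} × {0} × ℝⁿ`. -/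
def fracDist (d : ℝ → ℝ) (X : Euc (n + 2)) : ℝ := max |X 1| (d (X 0))

lemma abs_apply_sub_le {N : ℕ} (X Y : Euc N) (i : Fin N) : |X i - Y i| ≤ ‖X - Y‖ := by
  simpa using PiLp.norm_apply_le (X - Y) i

lemma abs_fracDist_sub_le (hd : ∀ x y, |d x - d y| ≤ |x - y|) (X Y : Euc (n + 2)) :
    |fracDist d X - fracDist d Y| ≤ ‖X - Y‖ := by
  refine (abs_max_sub_max_le_max _ _ _ _).trans (max_le ?_ ?_)
  · exact (abs_abs_sub_abs_le_abs_sub _ _).trans (abs_apply_sub_le X Y 1)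
  · exact (hd _ _).trans (abs_apply_sub_le X Y 0)

lemma fracDist_nonneg (X : Euc (n + 2)) : 0 ≤ fracDist d X := (abs_nonneg _).trans (le_max_left _ _)

lemma continuous_fracDist (hd : Continuous d) : Continuous (fracDist d (n := n)) := by
  unfold fracDist; fun_prop

lemma volume_setOf_forall_mem {N : ℕ} (A : Fin N → Set ℝ) :
    volume {X : Euc N | ∀ i, X i ∈ A i} = ∏ i, volume (A i) := by
  rw [← volume_pi_pi, ← (EuclideanSpace.volume_preserving_symm_measurableEquiv_toLp
    (Fin N)).measure_preimage_equiv]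
  congr 1
  ext X
  simp

lemma volume_fracDist_lt_le {K D : ℝ} (hK : 0 ≤ K)
    (hv : ∀ r, 0 < r → r ≤ 1 → volume {x | d x < r} ≤ ENNReal.ofReal (K * r ^ (1 - D))) {r : ℝ}
    (hr : 0 < r) (hr1 : r ≤ 1) :
    volume.restrict (Omg (n + 2)) {X | fracDist d X < r} ≤
      ENNReal.ofReal (K * 2 * (2 * √(n + 2 : ℕ)) ^ n * r ^ (2 - D)) := by
  set R := √(n + 2 : ℕ)
  let A : Fin (n + 2) → Set ℝ := Fin.cons {x | d x < r} (Fin.cons (Set.Ioo (-r) r) fun _ =>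
    Set.Icc (-R) R)
  have hR : 0 ≤ R := Real.sqrt_nonneg _
  have hsub : {X | fracDist d X < r} ∩ Omg (n + 2) ⊆ {X | ∀ i, X i ∈ A i} := by
    rintro X ⟨hX, hXO⟩
    obtain ⟨h1, h0⟩ := max_lt_iff.1 (show max |X 1| (d (X 0)) < r from hX)
    refine Fin.cases h0 (Fin.cases (abs_lt.1 h1) fun i => ?_)
    have h2 : ‖X‖ < R := mem_ball_zero_iff.1 hXO
    have h3 := PiLp.norm_apply_le X i.succ.succ
    exact abs_le.1 (h3.trans h2.le)
  rw [Measure.restrict_apply' isOpen_omg.measurableSet]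
  refine (measure_mono hsub).trans ?_
  rw [volume_setOf_forall_mem, Fin.prod_univ_succ, Fin.prod_univ_succ]
  simp only [A, Fin.cons_zero, Fin.cons_succ, Real.volume_Ioo, Real.volume_Icc, Finset.prod_const,
    Finset.card_univ, Fintype.card_fin]
  refine (mul_le_mul_left (hv r hr hr1) _).trans ?_
  rw [← ENNReal.ofReal_pow (by linarith), ← ENNReal.ofReal_mul (by linarith),
    ← ENNReal.ofReal_mul (by positivity)]
  refine le_of_eq (congr_arg _ ?_)
  rw [show 2 - D = 1 - D + 1 by ring, Real.rpow_add_one hr.ne']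
  ring

end fracDist

section barriers

variable {n : ℕ} {D : ℝ}

lemma Staircase.continuous_d (S : Staircase D) : Continuous S.d :=
  (LipschitzWith.of_dist_le' (K := 1) fun x y => by
    rw [one_mul, Real.dist_eq, Real.dist_eq]; exact S.d_lip x y).continuous

lemma Staircase.continuous_F (S : Staircase D) (hD : 0 < D) : Continuous S.F := by
  refine continuous_iff_continuousAt.2 fun x => ?_
  rw [ContinuousAt, tendsto_iff_dist_tendsto_zero]
  have h : Tendsto (fun y => S.K * |y - x| ^ D) (𝓝 x) (𝓝 0) := by
    have : Continuous fun y : ℝ => S.K * |y - x| ^ D :=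
      continuous_const.mul ((by fun_prop : Continuous fun y : ℝ => |y - x|).rpow_const
        fun _ => Or.inr hD.le)
    simpa [hD.ne'] using this.tendsto x
  exact squeeze_zero (fun _ => dist_nonneg) (fun y => S.holder y x) h

lemma Staircase.abs_F_le (S : Staircase D) (x : ℝ) : |S.F x| ≤ 1 := by
  obtain ⟨h0, h1⟩ := stair_mem S.mono S.eq_zero S.eq_one x
  rwa [abs_of_nonneg h0]

lemma Staircase.K_nonneg (S : Staircase D) : 0 ≤ S.K := by
  have := S.holder 1 0
  simp only [sub_zero, abs_one, Real.one_rpow, mul_one] at this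
  exact (abs_nonneg _).trans this

/-- The function jumping from `0` to `1` across `{X 1 = 0}`. -/
def jumpFun (d : ℝ → ℝ) (X : Euc (n + 2)) : ℝ := ramp (fracDist d X) (X 1)

/-- The average of `F` in the direction of `X 0` at scale `|X 1|`. -/
def stairFun (F : ℝ → ℝ) (X : Euc (n + 2)) : ℝ := avg F (X 0) |X 1|

lemma regAway_jumpFun (S : Staircase D) : RegAway (fracDist S.d (n := n)) 1 (jumpFun S.d) := by
  refine ⟨3, 1, by norm_num, by norm_num, fun X => abs_ramp_le (fracDist_nonneg X),
    fun ε hε _ => ⟨fun X => ramp (max (fracDist S.d X) ε) (X 1), fun X Y => ?_,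
      fun X => abs_ramp_le (hε.le.trans (le_max_right _ _)), fun X hX => ?_⟩⟩
  · refine (abs_ramp_sub_le hε (le_max_right _ _) (le_max_right _ _)).trans ?_
    have h1 := (abs_max_sub_max_le_abs (fracDist S.d X) (fracDist S.d Y) ε).trans
      (abs_fracDist_sub_le S.d_lip X Y)
    have h2 := abs_apply_sub_le X Y 1
    rw [Real.rpow_neg_one, show 3 * ε⁻¹ * ‖X - Y‖ = ε⁻¹ * (‖X - Y‖ + 2 * ‖X - Y‖) by ring]
    gcongr
  · show ramp _ _ = _
    rw [max_eq_left hX, jumpFun]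

lemma regAway_stairFun (S : Staircase D) (hD : 0 < D) (hD1 : D ≤ 1) :
    RegAway (fracDist S.d (n := n)) (1 - D) (stairFun S.F) := by
  have hF := S.continuous_F hD
  refine ⟨8 * S.K * 2 ^ (1 - D), 1, by have := S.K_nonneg; positivity, by norm_num,
    fun X => abs_avg_le S.abs_F_le _ _, fun ε hε _ =>
      ⟨fun X => avg S.F (X 0) (max |X 1| (ε / 2)), fun X Y => ?_,
        fun X => abs_avg_le S.abs_F_le _ _, fun X hX => ?_⟩⟩
  · refine (abs_avg_sub_le hF S.K_nonneg hD.le hD1 S.holder (half_pos hε) (le_max_right _ _)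
      (le_max_right _ _)).trans ?_
    have h1 := (abs_max_sub_max_le_abs |X 1| |Y 1| (ε / 2)).trans
      ((abs_abs_sub_abs_le_abs_sub _ _).trans (abs_apply_sub_le X Y 1))
    have h2 := abs_apply_sub_le X Y 0
    have hK := S.K_nonneg
    have e : (ε / 2) ^ (-(1 - D)) = ε ^ (-(1 - D)) * 2 ^ (1 - D) := by
      rw [Real.div_rpow hε.le zero_le_two, Real.rpow_neg zero_le_two, div_inv_eq_mul]
    rw [e, show 8 * S.K * 2 ^ (1 - D) * ε ^ (-(1 - D)) * ‖X - Y‖ =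
      4 * S.K * (ε ^ (-(1 - D)) * 2 ^ (1 - D)) * (‖X - Y‖ + ‖X - Y‖) by ring]
    gcongr
  · show avg _ _ _ = _
    rcases le_or_gt (ε / 2) |X 1| with h | h
    · rw [max_eq_left h, stairFun]
    · have hd : ε ≤ S.d (X 0) := (le_max_iff.1 hX).resolve_left (by linarith)
      have key : ∀ r, |r| ≤ ε / 2 → avg S.F (X 0) r = S.F (X 0) := fun r hr =>
        avg_eq_of_forall fun z hz => S.eq_of_lt _ _ (by linarith)
      rw [max_eq_right h.le, stairFun, key _ (by rw [abs_of_pos (half_pos hε)]),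
        key _ (by rw [abs_abs]; exact h.le)]

lemma continuous_apply_euc {N : ℕ} (i : Fin N) : Continuous fun X : Euc N => X i := by fun_prop

lemma jumpFun_eventuallyEq_one (S : Staircase D) {X : Euc (n + 2)} (h : 0 < fracDist S.d X)
    (hX : fracDist S.d X / 4 < X 1) : jumpFun S.d =ᶠ[𝓝 X] fun _ => 1 := by
  have hc := continuous_fracDist (n := n) S.continuous_d
  filter_upwards [hc.continuousAt.eventually (lt_mem_nhds h),
    (hc.div_const 4).continuousAt.eventually_lt (continuous_apply_euc 1).continuousAt hX]
    with Y h1 h2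
  exact ramp_of_ge h1 h2.le

lemma jumpFun_eventuallyEq_zero (S : Staircase D) {X : Euc (n + 2)} (h : 0 < fracDist S.d X)
    (hX : X 1 < -(fracDist S.d X / 4)) : jumpFun S.d =ᶠ[𝓝 X] fun _ => 0 := by
  have hc := continuous_fracDist (n := n) S.continuous_d
  filter_upwards [hc.continuousAt.eventually (lt_mem_nhds h),
    (continuous_apply_euc 1).continuousAt.eventually_lt (hc.div_const 4).neg.continuousAt hX]
    with Y h1 h2
  exact ramp_of_le h1 h2.le

lemma gradient_eq_zero_of_eventuallyEq_const {N : ℕ} {f : Euc N → ℝ} {X : Euc N} {c : ℝ}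
    (h : f =ᶠ[𝓝 X] fun _ => c) : gradient f X = 0 := by
  rw [← norm_eq_zero, norm_gradient, h.fderiv_eq, fderiv_const_apply, norm_zero]

lemma abs_le_of_gradient_jumpFun_ne (S : Staircase D) {X : Euc (n + 2)} (h : 0 < fracDist S.d X)
    (hX : gradient (jumpFun S.d) X ≠ 0) : |X 1| ≤ S.d (X 0) / 4 := by
  by_contra! hlt
  have h0 := S.d_nonneg (X 0)
  have h1 : fracDist S.d X / 4 < |X 1| := by
    rw [div_lt_iff₀ four_pos, fracDist, max_lt_iff]
    constructor <;> linarith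
  rcases lt_abs.1 h1 with h2 | h2
  · exact hX (gradient_eq_zero_of_eventuallyEq_const (jumpFun_eventuallyEq_one S h h2))
  · exact hX (gradient_eq_zero_of_eventuallyEq_const (jumpFun_eventuallyEq_zero S h (by linarith)))

lemma stairFun_eq (S : Staircase D) {X : Euc (n + 2)} (h : |X 1| < S.d (X 0)) :
    stairFun S.F X = S.F (X 0) :=
  avg_eq_of_forall fun z hz => S.eq_of_lt _ _ (by rw [abs_abs] at hz; linarith)

lemma stairFun_eventuallyEq (S : Staircase D) {X : Euc (n + 2)} (h : |X 1| < S.d (X 0)) :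
    stairFun S.F =ᶠ[𝓝 X] fun _ => S.F (X 0) := by
  filter_upwards [(continuous_apply_euc 1).abs.continuousAt.eventually_lt
    (S.continuous_d.comp (continuous_apply_euc 0)).continuousAt h,
    (by fun_prop : Continuous fun Y : Euc (n + 2) => |Y 0 - X 0|).continuousAt.eventually_lt
      continuousAt_const (show |X 0 - X 0| < S.d (X 0) by
        rw [sub_self, abs_zero]; exact (abs_nonneg _).trans_lt h)] with Y h1 h2
  rw [stairFun_eq S h1]
  exact S.eq_of_lt _ _ h2

lemma le_abs_of_gradient_stairFun_ne (S : Staircase D) {X : Euc (n + 2)}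
    (hX : gradient (stairFun S.F) X ≠ 0) : S.d (X 0) ≤ |X 1| := by
  by_contra! hlt
  exact hX (gradient_eq_zero_of_eventuallyEq_const (stairFun_eventuallyEq S hlt))

end barriers

section smoothStep

/-- A smooth monotone step from `0` to `1` on `[-1/8, 1/8]`. -/
def smoothStep (y : ℝ) : ℝ := Real.smoothTransition (4 * y + 1 / 2)

lemma contDiff_smoothStep : ContDiff ℝ (⊤ : ℕ∞) smoothStep :=
  Real.smoothTransition.contDiff.comp (by fun_prop)

lemma differentiable_smoothStep : Differentiable ℝ smoothStep :=
  contDiff_smoothStep.differentiable (by simp)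

lemma smoothStep_mono : Monotone smoothStep := fun _ _ h =>
  Real.smoothTransition.monotone (by linarith)

lemma abs_smoothStep_le (y : ℝ) : |smoothStep y| ≤ 1 := by
  rw [smoothStep, abs_of_nonneg (Real.smoothTransition.nonneg _)]
  exact Real.smoothTransition.le_one _

lemma smoothStep_of_ge {y : ℝ} (h : 1 / 8 ≤ y) : smoothStep y = 1 :=
  Real.smoothTransition.one_of_one_le (by linarith)

lemma smoothStep_of_le {y : ℝ} (h : y ≤ -(1 / 8)) : smoothStep y = 0 :=
  Real.smoothTransition.zero_of_nonpos (by linarith)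

lemma deriv_smoothStep_nonneg (y : ℝ) : 0 ≤ deriv smoothStep y := smoothStep_mono.deriv_nonneg

lemma exists_deriv_smoothStep_pos : ∃ y, 0 < y ∧ y < 1 / 8 ∧ 0 < deriv smoothStep y := by
  obtain ⟨y, hy, h⟩ := exists_deriv_eq_slope smoothStep (a := 0) (b := 1 / 8) (by norm_num)
    differentiable_smoothStep.continuous.continuousOn differentiable_smoothStep.differentiableOn
  refine ⟨y, hy.1, hy.2, ?_⟩
  have h1 : smoothStep 0 < 1 := Real.smoothTransition.lt_one_of_lt_one (by norm_num)
  rw [h, smoothStep_of_ge le_rfl]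
  exact div_pos (by linarith) (by norm_num)

lemma continuous_deriv_smoothStep : Continuous (deriv smoothStep) :=
  contDiff_smoothStep.continuous_deriv (by simp)

lemma exists_abs_smoothStep_sub_le : ∃ K, 0 ≤ K ∧
    ∀ x y, |smoothStep x - smoothStep y| ≤ K * |x - y| := by
  have hs : HasCompactSupport (deriv smoothStep) := by
    refine HasCompactSupport.intro (isCompact_Icc (a := -(1 / 8 : ℝ)) (b := 1 / 8)) fun y hy => ?_
    rw [Set.mem_Icc, not_and_or, not_le, not_le] at hy
    rcases hy with hy | hy
    · have : smoothStep =ᶠ[𝓝 y] fun _ => 0 := by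
        filter_upwards [gt_mem_nhds hy] with z hz using smoothStep_of_le hz.le
      rw [this.deriv_eq, deriv_const]
    · have : smoothStep =ᶠ[𝓝 y] fun _ => 1 := by
        filter_upwards [lt_mem_nhds hy] with z hz using smoothStep_of_ge hz.le
      rw [this.deriv_eq, deriv_const]
  obtain ⟨K, hK⟩ := continuous_deriv_smoothStep.bounded_above_of_compact_support hs
  exact ⟨K, (norm_nonneg _).trans (hK 0), fun x y => convex_univ.norm_image_sub_le_of_norm_deriv_le
    (fun z _ => differentiable_smoothStep z) (fun z _ => hK z) (Set.mem_univ y) (Set.mem_univ x)⟩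

variable {N : ℕ}

lemma contDiff_smoothStep_apply (i : Fin N) :
    ContDiff ℝ (⊤ : ℕ∞) fun X : Euc N => smoothStep (X i) :=
  contDiff_smoothStep.comp (EuclideanSpace.proj (𝕜 := ℝ) i).contDiff

lemma gradient_smoothStep_apply (i j : Fin N) (X : Euc N) :
    gradient (fun X : Euc N => smoothStep (X i)) X j =
        if j = i then deriv smoothStep (X i) else 0 := by
  have h : HasFDerivAt (fun X : Euc N => smoothStep (X i))
      (deriv smoothStep (X i) • (EuclideanSpace.proj i : Euc N →L[ℝ] ℝ)) X :=
    HasDerivAt.comp_hasFDerivAt (f := fun X : Euc N => X i) X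
      (differentiable_smoothStep (X i)).hasDerivAt (EuclideanSpace.proj (𝕜 := ℝ) i).hasFDerivAt
  rw [gradient_apply, h.fderiv]
  simp [eq_comm]

end smoothStep

section tail

variable {n : ℕ}

/-- The projection forgetting the first two coordinates. -/
def tailProj (n : ℕ) : Euc (n + 2) →L[ℝ] Euc n :=
  LinearMap.toContinuousLinearMap
    { toFun := fun X => WithLp.toLp 2 fun i => X i.succ.succ
      map_add' := fun X Y => by ext; simp
      map_smul' := fun c X => by ext; simp }

@[simp] lemma tailProj_apply (X : Euc (n + 2)) (i : Fin n) : tailProj n X i = X i.succ.succ := rfl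

lemma norm_tailProj_le (X : Euc (n + 2)) : ‖tailProj n X‖ ≤ ‖X‖ := by
  rw [← sq_le_sq₀ (norm_nonneg _) (norm_nonneg _), EuclideanSpace.norm_sq_eq,
    EuclideanSpace.norm_sq_eq, Fin.sum_univ_succ, Fin.sum_univ_succ]
  simp only [tailProj_apply]
  have := sq_nonneg ‖X 0‖
  have := sq_nonneg ‖X (Fin.succ 0)‖
  linarith

/-- The excess of the last coordinates over `1 / 2`. -/
def tailExcess (X : Euc (n + 2)) : ℝ := max (‖tailProj n X‖ - 1 / 2) 0

lemma tailExcess_nonneg (X : Euc (n + 2)) : 0 ≤ tailExcess X := le_max_right _ _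

lemma abs_tailExcess_sub_le (X Y : Euc (n + 2)) : |tailExcess X - tailExcess Y| ≤ ‖X - Y‖ := by
  refine (abs_max_sub_max_le_abs _ _ _).trans ?_
  rw [sub_sub_sub_cancel_right]
  refine (abs_norm_sub_norm_le _ _).trans ?_
  rw [← map_sub]
  exact norm_tailProj_le _

lemma le_tailExcess {X : Euc (n + 2)} {i : Fin n} (h : 3 / 4 ≤ |X i.succ.succ|) :
    1 / 4 ≤ tailExcess X := by
  have := PiLp.norm_apply_le (tailProj n X) i
  rw [tailProj_apply, Real.norm_eq_abs] at this
  exact (show 1 / 4 ≤ ‖tailProj n X‖ - 1 / 2 by linarith).trans (le_max_left _ _)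

/-- A smooth bump in the last coordinates. -/
def tailBump (n : ℕ) : ContDiffBump (0 : Euc n) := ⟨1 / 4, 1 / 2, by norm_num, by norm_num⟩

/-- A smooth cutoff in the last coordinates. -/
def tailCutoff (X : Euc (n + 2)) : ℝ := tailBump n (tailProj n X)

lemma contDiff_tailCutoff : ContDiff ℝ (⊤ : ℕ∞) (tailCutoff (n := n)) :=
  (tailBump n).contDiff.comp (tailProj n).contDiff

lemma tailExcess_eq_zero {X : Euc (n + 2)} (h : tailCutoff X ≠ 0) : tailExcess X = 0 := by
  have : tailProj n X ∈ Function.support (tailBump n) := h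
  rw [(tailBump n).support_eq, mem_ball_zero_iff] at this
  exact max_eq_right (sub_nonpos.2 this.le)

lemma fderiv_tailCutoff_single {i : Fin (n + 2)} (hi : tailProj n (EuclideanSpace.single i 1) = 0)
    (X : Euc (n + 2)) : fderiv ℝ tailCutoff X (EuclideanSpace.single i 1) = 0 := by
  have h : HasFDerivAt tailCutoff ((fderiv ℝ (tailBump n) (tailProj n X)).comp (tailProj n)) X :=
    (((tailBump n).contDiff (n := 1)).differentiable (by simp) _).hasFDerivAt.comp X
      (tailProj n).hasFDerivAt
  rw [h.fderiv, ContinuousLinearMap.comp_apply, hi, map_zero]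

lemma tailProj_single_zero : tailProj n (EuclideanSpace.single 0 1) = 0 := by
  ext i; simp [Fin.succ_ne_zero]

lemma tailProj_single_one : tailProj n (EuclideanSpace.single 1 1) = 0 := by
  ext i
  have : i.succ.succ ≠ 1 := fun h => Fin.succ_ne_zero i (Fin.succ_injective _ h)
  simp [this]

lemma exists_le_abs_apply {N : ℕ} (hN : 0 < N) {c : ℝ} (hc : 0 ≤ c) {X : Euc N} (h : c * √N ≤ ‖X‖) :
    ∃ i, c ≤ |X i| := by
  by_contra! hlt
  have : Nonempty (Fin N) := ⟨⟨0, hN⟩⟩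
  have h1 : ‖X‖ ^ 2 < ∑ _i : Fin N, c ^ 2 := by
    rw [EuclideanSpace.norm_sq_eq]
    exact Finset.sum_lt_sum_of_nonempty Finset.univ_nonempty fun i _ =>
      pow_lt_pow_left₀ (hlt i) (abs_nonneg _) two_ne_zero
  have h2 : (c * √N) ^ 2 ≤ ‖X‖ ^ 2 := pow_le_pow_left₀ (by positivity) h 2
  rw [mul_pow, Real.sq_sqrt (by positivity)] at h2
  rw [Finset.sum_const, Finset.card_univ, Fintype.card_fin, nsmul_eq_mul] at h1
  linarith

/-- Away from the centre of the ball one of the coordinates is large. -/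
lemma le_abs_or_le_tailExcess {X : Euc (n + 2)} (h : 3 / 4 * √(n + 2 : ℕ) ≤ ‖X‖) :
    3 / 4 ≤ |X 0| ∨ 3 / 4 ≤ |X 1| ∨ 1 / 4 ≤ tailExcess X := by
  obtain ⟨i, hi⟩ := exists_le_abs_apply (by omega) (by norm_num) h
  revert hi
  refine Fin.cases (fun h => Or.inl h) (Fin.cases (fun h => Or.inr (Or.inl h)) fun i h => ?_) i
  exact Or.inr (Or.inr (le_tailExcess h))

end tail

section cross

variable {n : ℕ} {D : ℝ}

lemma tailCutoff_nonneg (X : Euc (n + 2)) : 0 ≤ tailCutoff X := (tailBump n).nonneg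

lemma tailCutoff_le_one (X : Euc (n + 2)) : tailCutoff X ≤ 1 := (tailBump n).le_one

lemma integral_cross_smoothStep_ne_zero {v : Euc (n + 2) → ℝ} {i j : Fin (n + 2)} (hij : j ≠ i)
    (hv : IntegrableOn (gradient v) (Omg (n + 2)))
    (h0 : ∀ᵐ X ∂volume.restrict (Omg (n + 2)), 0 ≤ gradient v X j)
    {U : Set (Euc (n + 2))} (hU : IsOpen U) (hne : U.Nonempty) (hUO : U ⊆ Omg (n + 2))
    (hUs : ∀ X ∈ U, 0 < deriv smoothStep (X i)) (hUc : ∀ X ∈ U, tailCutoff X ≠ 0)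
    (hUv : ∀ᵐ X ∂volume.restrict (Omg (n + 2)), X ∈ U → 0 < gradient v X j) :
    ∫ X in Omg (n + 2), (gradient v X j * (tailCutoff X *
      gradient (fun X : Euc (n + 2) => smoothStep (X i)) X i) - gradient v X i * (tailCutoff X *
      gradient (fun X : Euc (n + 2) => smoothStep (X i)) X j)) ≠ 0 := by
  simp only [gradient_smoothStep_apply, if_true, if_neg hij, mul_zero, sub_zero]
  have hc : Continuous fun X : Euc (n + 2) => tailCutoff X * deriv smoothStep (X i) :=
    contDiff_tailCutoff.continuous.mul (continuous_deriv_smoothStep.comp (continuous_apply_euc i))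
  have hvj : IntegrableOn (fun X => gradient v X j) (Omg (n + 2)) :=
    (EuclideanSpace.proj (𝕜 := ℝ) j).integrable_comp hv
  have hint : IntegrableOn (fun X => gradient v X j * (tailCutoff X * deriv smoothStep (X i)))
      (Omg (n + 2)) :=
    hvj.mul_continuousOn_of_subset hc.continuousOn isOpen_omg.measurableSet
      (isCompact_closedBall 0 √(n + 2 : ℕ)) Metric.ball_subset_closedBall
  refine ne_of_gt ((integral_pos_iff_support_of_nonneg_ae ?_ hint).2 ?_)
  · filter_upwards [h0] with X hX
    exact mul_nonneg hX (mul_nonneg (tailCutoff_nonneg X) (deriv_smoothStep_nonneg _))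
  · have h1 : 0 < volume.restrict (Omg (n + 2)) U := by
      rw [Measure.restrict_apply hU.measurableSet, Set.inter_eq_left.2 hUO]
      exact hU.measure_pos volume hne
    refine h1.trans_le (measure_mono_ae ?_)
    filter_upwards [hUv] with X hX hXU
    exact (mul_pos (hX hXU) (mul_pos ((tailCutoff_nonneg X).lt_of_ne' (hUc X hXU))
      (hUs X hXU))).ne'

lemma gradient_apply_eq_deriv {N : ℕ} {v : Euc N → ℝ} {X : Euc N} (hv : DifferentiableAt ℝ v X)
    (j : Fin N) : gradient v X j =
        deriv (fun s : ℝ => v (X + s • EuclideanSpace.single j 1)) 0 := by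
  rw [gradient_apply, ← hv.lineDeriv_eq_fderiv, lineDeriv]

lemma stairFun_add_smul (F : ℝ → ℝ) (X : Euc (n + 2)) (s : ℝ) :
    stairFun F (X + s • EuclideanSpace.single 0 1) = avg F (X 0 + s) |X 1| := by
  simp [stairFun]

lemma gradient_stairFun_nonneg (S : Staircase D) (hD : 0 < D) {X : Euc (n + 2)}
    (hX : DifferentiableAt ℝ (stairFun S.F) X) : 0 ≤ gradient (stairFun S.F) X 0 := by
  rw [gradient_apply_eq_deriv hX]
  refine Monotone.deriv_nonneg fun s t h => ?_
  rw [stairFun_add_smul, stairFun_add_smul]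
  exact avg_mono (S.continuous_F hD) S.mono _ (by linarith)

lemma gradient_stairFun_apply_zero (S : Staircase D) (hD : 0 < D) {X : Euc (n + 2)}
    (hX : DifferentiableAt ℝ (stairFun S.F) X) (h1 : 0 < X 1) :
    gradient (stairFun S.F) X 0 = (S.F (X 0 + X 1) - S.F (X 0 - X 1)) / (2 * X 1) := by
  rw [gradient_apply_eq_deriv hX]
  simp only [stairFun_add_smul, abs_of_pos h1]
  have := hasDerivAt_avg (S.continuous_F hD) (X 0 + 0) h1
  rw [add_zero] at this
  exact (HasDerivAt.comp_const_add (X 0) 0 (by rwa [add_zero])).deriv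

lemma jumpFun_add_smul (d : ℝ → ℝ) {X : Euc (n + 2)} (hX : 0 < d (X 0)) (s : ℝ) :
    jumpFun d (X + s • EuclideanSpace.single 1 1) = ramp (d (X 0)) (X 1 + s) := by
  simp [jumpFun, fracDist, ramp_max_abs hX]

lemma gradient_jumpFun_nonneg (S : Staircase D) {X : Euc (n + 2)} (h : 0 < fracDist S.d X)
    (hX : DifferentiableAt ℝ (jumpFun S.d) X) : 0 ≤ gradient (jumpFun S.d) X 1 := by
  by_cases h0 : gradient (jumpFun S.d) X = 0
  · simp [h0]
  have h1 := abs_le_of_gradient_jumpFun_ne S h h0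
  have hd : 0 < S.d (X 0) := by
    rcases lt_max_iff.1 h with h2 | h2
    · linarith
    · exact h2
  rw [gradient_apply_eq_deriv hX]
  refine Monotone.deriv_nonneg fun s t h => ?_
  rw [jumpFun_add_smul _ hd, jumpFun_add_smul _ hd]
  exact ramp_mono hd.le (by linarith)

lemma gradient_jumpFun_apply_one (S : Staircase D) {X : Euc (n + 2)}
    (hX : DifferentiableAt ℝ (jumpFun S.d) X) (h1 : |X 1| < S.d (X 0) / 4) :
    gradient (jumpFun S.d) X 1 = 2 / S.d (X 0) := by
  have hd : 0 < S.d (X 0) := by linarith [abs_nonneg (X 1)]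
  rw [gradient_apply_eq_deriv hX]
  simp only [jumpFun_add_smul _ hd]
  have he : (fun s => ramp (S.d (X 0)) (X 1 + s)) =ᶠ[𝓝 0]
      fun s => 1 / 2 + 2 * (X 1 + s) / S.d (X 0) := by
    filter_upwards [(by fun_prop : Continuous fun s => |X 1 + s|).continuousAt.eventually_lt
      continuousAt_const (show |X 1 + 0| < S.d (X 0) / 4 by rwa [add_zero])] with s hs
    exact ramp_of_abs_le hs.le
  rw [he.deriv_eq]
  simp

lemma Staircase.exists_lt (S : Staircase D) {r : ℝ} (hr : 0 < r) :
    ∃ x, |x| < 1 / 4 + r ∧ S.F (x - r) < S.F (x + r) := by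
  suffices h : ∃ x, S.F (x - r) < S.F (x + r) by
    obtain ⟨x, hx⟩ := h
    refine ⟨x, abs_lt.2 ⟨?_, ?_⟩, hx⟩
    · by_contra! h
      rw [S.eq_zero _ (by linarith), S.eq_zero _ (by linarith)] at hx
      exact hx.false
    · by_contra! h
      rw [S.eq_one _ (by linarith), S.eq_one _ (by linarith)] at hx
      exact hx.false
  by_contra! h
  have hk : ∀ k : ℕ, S.F (-(1 / 4) + k * (2 * r)) ≤ 0 := by
    intro k
    induction k with
    | zero => rw [Nat.cast_zero, zero_mul, add_zero, S.eq_zero _ le_rfl]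
    | succ k ih =>
      refine le_trans (le_of_eq_of_le ?_ (h (-(1 / 4) + k * (2 * r) + r))) (le_of_eq_of_le ?_ ih)
      · congr 1; push_cast; ring
      · congr 1; ring
  obtain ⟨k, hk'⟩ := exists_nat_ge (1 / (2 * r))
  rw [div_le_iff₀ (by positivity)] at hk'
  have := hk k
  rw [S.eq_one _ (by linarith)] at this
  linarith

lemma Staircase.ae_pos (S : Staircase D) (hD1 : D < 1) : ∀ᵐ x, 0 < S.d x :=
  ae_pos_of_measure_lt (sub_pos.2 hD1) S.volume_le

/-- The point with first coordinates `x, y` and all others zero. -/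
def planePt (n : ℕ) (x y : ℝ) : Euc (n + 2) :=
  x • EuclideanSpace.single 0 1 + y • EuclideanSpace.single 1 1

@[simp] lemma planePt_zero (x y : ℝ) : planePt n x y 0 = x := by simp [planePt]

@[simp] lemma planePt_one (x y : ℝ) : planePt n x y 1 = y := by simp [planePt]

lemma planePt_mem {x y : ℝ} (h : |x| + |y| < 1) : planePt n x y ∈ Omg (n + 2) := by
  rw [Omg, mem_ball_zero_iff]
  have h1 : ‖planePt n x y‖ ≤ |x| + |y| := by
    refine (norm_add_le _ _).trans ?_
    simp [norm_smul]
  refine (h1.trans_lt h).trans_le (Real.one_le_sqrt.2 ?_)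
  push_cast
  linarith [n.cast_nonneg (α := ℝ)]

lemma tailCutoff_planePt (x y : ℝ) : tailCutoff (planePt n x y) = 1 := by
  have : tailProj n (planePt n x y) = 0 := by
    simp [planePt, tailProj_single_zero, tailProj_single_one]
  rw [tailCutoff, this]
  exact (tailBump n).one_of_mem_closedBall (by simp [tailBump])

end cross

section construction

variable {n : ℕ} {D : ℝ}

/-- A function positive where `stairFun` varies and negative where `jumpFun` varies. -/
def sideFun (d : ℝ → ℝ) (X : Euc (n + 2)) : ℝ := |X 1| - d (X 0) / 2

lemma abs_sideFun_sub_le (S : Staircase D) (X Y : Euc (n + 2)) :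
    |sideFun S.d X - sideFun S.d Y| ≤ 2 * ‖X - Y‖ := by
  have h1 := abs_le.1 ((abs_abs_sub_abs_le_abs_sub _ _).trans (abs_apply_sub_le X Y 1))
  have h2 := abs_le.1 ((S.d_lip _ _).trans (abs_apply_sub_le X Y 0))
  have := norm_nonneg (X - Y)
  unfold sideFun
  exact abs_le.2 ⟨by linarith, by linarith⟩

lemma abs_sub_two_mul_tailExcess_sub_le {h : Euc (n + 2) → ℝ}
    (hh : ∀ X Y, |h X - h Y| ≤ 2 * ‖X - Y‖) (X Y : Euc (n + 2)) :
    |(h X - 2 * tailExcess X) - (h Y - 2 * tailExcess Y)| ≤ 4 * ‖X - Y‖ := by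
  have h1 := abs_le.1 (hh X Y)
  have h2 := abs_le.1 (abs_tailExcess_sub_le X Y)
  exact abs_le.2 ⟨by linarith, by linarith⟩

lemma le_sideFun_of_gradient_stairFun_ne (S : Staircase D) {X : Euc (n + 2)}
    (hX : gradient (stairFun S.F) X ≠ 0) : fracDist S.d X / 4 ≤ sideFun S.d X := by
  have h := le_abs_of_gradient_stairFun_ne S hX
  have := S.d_nonneg (X 0)
  rw [sideFun, fracDist, max_eq_left h]
  linarith

lemma sideFun_le_of_gradient_jumpFun_ne (S : Staircase D) {X : Euc (n + 2)}
    (h : 0 < fracDist S.d X) (hX : gradient (jumpFun S.d) X ≠ 0) :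
    sideFun S.d X ≤ -(fracDist S.d X / 4) := by
  have h1 := abs_le_of_gradient_jumpFun_ne S h hX
  have := S.d_nonneg (X 0)
  rw [sideFun, fracDist, max_eq_right (by linarith)]
  linarith

lemma smoothStep_apply_eventuallyEq_one {N : ℕ} {i : Fin N} {X : Euc N} (h : 1 / 8 < X i) :
    (fun X : Euc N => smoothStep (X i)) =ᶠ[𝓝 X] fun _ => 1 := by
  filter_upwards [(continuous_apply_euc i).continuousAt.eventually (lt_mem_nhds h)] with Y hY
  exact smoothStep_of_ge hY.le

lemma smoothStep_apply_eventuallyEq_zero {N : ℕ} {i : Fin N} {X : Euc N} (h : X i < -(1 / 8)) :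
    (fun X : Euc N => smoothStep (X i)) =ᶠ[𝓝 X] fun _ => 0 := by
  filter_upwards [(continuous_apply_euc i).continuousAt.eventually (gt_mem_nhds h)] with Y hY
  exact smoothStep_of_le hY.le

lemma jumpFun_eventuallyEq_smoothStep (S : Staircase D) {X : Euc (n + 2)}
    (hδ : 0 < fracDist S.d X) (hX : 3 / 4 * √(n + 2 : ℕ) ≤ ‖X‖)
    (hb : 0 ≤ sideFun S.d X - 2 * tailExcess X) :
    jumpFun S.d =ᶠ[𝓝 X] fun X => smoothStep (X 1) := by
  have hd := S.d_nonneg (X 0)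
  have hd' := S.le_d (X 0)
  have hτ := tailExcess_nonneg X
  rw [sideFun] at hb
  have h1 : 1 / 4 ≤ |X 1| := by
    rcases le_abs_or_le_tailExcess hX with h | h | h <;> linarith
  have h2 : fracDist S.d X / 4 < |X 1| := by
    rw [div_lt_iff₀ four_pos, fracDist, max_lt_iff]
    constructor <;> linarith
  rcases le_total 0 (X 1) with h0 | h0
  · rw [abs_of_nonneg h0] at h1 h2
    exact (jumpFun_eventuallyEq_one S hδ h2).trans
      (smoothStep_apply_eventuallyEq_one (by linarith)).symm
  · rw [abs_of_nonpos h0] at h1 h2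
    exact (jumpFun_eventuallyEq_zero S hδ (by linarith)).trans
      (smoothStep_apply_eventuallyEq_zero (by linarith)).symm

lemma stairFun_eventuallyEq_smoothStep (S : Staircase D) {X : Euc (n + 2)}
    (hδ : 0 < fracDist S.d X) (hX : 3 / 4 * √(n + 2 : ℕ) ≤ ‖X‖)
    (hb : 0 ≤ -sideFun S.d X - 2 * tailExcess X) :
    stairFun S.F =ᶠ[𝓝 X] fun X => smoothStep (X 0) := by
  have hd := S.d_nonneg (X 0)
  have hd' := S.d_le (X 0)
  have hτ := tailExcess_nonneg X
  rw [sideFun] at hb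
  have h1 : 1 / 2 ≤ |X 0| := by
    rcases le_abs_or_le_tailExcess hX with h | h | h <;> linarith [abs_nonneg (X 1)]
  have h2 : |X 1| < S.d (X 0) := by
    rcases lt_max_iff.1 hδ with h | h <;> linarith
  rcases le_total 0 (X 0) with h0 | h0
  · rw [abs_of_nonneg h0] at h1
    have := stairFun_eventuallyEq S h2
    rw [S.eq_one _ (by linarith)] at this
    exact this.trans (smoothStep_apply_eventuallyEq_one (by linarith)).symm
  · rw [abs_of_nonpos h0] at h1
    have := stairFun_eventuallyEq S h2
    rw [S.eq_zero _ (by linarith)] at this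
    exact this.trans (smoothStep_apply_eventuallyEq_zero (by linarith)).symm

lemma fracDist_le (S : Staircase D) {X : Euc (n + 2)} (hX : X ∈ Omg (n + 2)) :
    fracDist S.d X ≤ √(n + 2 : ℕ) + 1 / 4 := by
  have h := (mem_ball_zero_iff.1 hX).le
  have h0 := PiLp.norm_apply_le X 0
  have h1 := PiLp.norm_apply_le X 1
  rw [Real.norm_eq_abs] at h0 h1
  exact max_le (by linarith) ((S.d_le _).trans (by linarith))

lemma ae_fracDist_pos (S : Staircase D) (hD1 : D < 1) :
    ∀ᵐ X ∂volume.restrict (Omg (n + 2)), 0 < fracDist S.d X :=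
  ae_pos_of_measure_lt (m := 2 - D) (by linarith) fun _ =>
    volume_fracDist_lt_le S.K_nonneg S.volume_le

lemma RegAway.integrableOn_gradient {S : Staircase D} (hD1 : D < 1) {s : ℝ} (hs : 0 ≤ s)
    (hs1 : s ≤ 1) {v : Euc (n + 2) → ℝ} (hv : RegAway (fracDist S.d) s v) :
    IntegrableOn (gradient v) (Omg (n + 2)) :=
  have hδ := continuous_fracDist S.continuous_d
  (hv.hasWeakGradOn hδ hs hs1 (ae_fracDist_pos S hD1)
    (integrable_inv_of_measure_lt hδ.measurable (m := 2 - D) (by linarith) fracDist_nonneg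
      fun _ => volume_fracDist_lt_le S.K_nonneg S.volume_le)).2.1

lemma integral_cross_stairFun_ne_zero (S : Staircase D) (hD : 0 < D) (hD1 : D < 1) :
    ∫ X in Omg (n + 2), (gradient (stairFun S.F) X 0 * (tailCutoff X *
      gradient (fun X : Euc (n + 2) => smoothStep (X 1)) X 1) -
      gradient (stairFun S.F) X 1 * (tailCutoff X *
      gradient (fun X : Euc (n + 2) => smoothStep (X 1)) X 0)) ≠ 0 := by
  have hreg := regAway_stairFun (n := n) S hD hD1.le
  have hdiff := hreg.ae_differentiableAt (continuous_fracDist S.continuous_d)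
    (ae_fracDist_pos S hD1)
  have hF := S.continuous_F hD
  obtain ⟨y, hy0, hy1, hy⟩ := exists_deriv_smoothStep_pos
  obtain ⟨x, hx, hxy⟩ := S.exists_lt hy0
  have hO : IsOpen {X : Euc (n + 2) | 0 < deriv smoothStep (X 1) ∧ 0 < X 1 ∧
      S.F (X 0 - X 1) < S.F (X 0 + X 1) ∧ tailCutoff X ≠ 0} :=
    (isOpen_lt continuous_const (continuous_deriv_smoothStep.comp (continuous_apply_euc 1))).inter
      ((isOpen_lt continuous_const (continuous_apply_euc 1)).inter
      ((isOpen_lt (hF.comp (by fun_prop)) (hF.comp (by fun_prop))).inter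
      (isOpen_ne_fun contDiff_tailCutoff.continuous continuous_const)))
  refine integral_cross_smoothStep_ne_zero (by simp)
    (hreg.integrableOn_gradient hD1 (by linarith) (by linarith)) ?_ (isOpen_omg.inter hO)
    ⟨planePt n x y, planePt_mem ?_, ?_⟩ Set.inter_subset_left (fun X hX => hX.2.1)
    (fun X hX => hX.2.2.2.2) ?_
  · filter_upwards [hdiff] with X hX using gradient_stairFun_nonneg S hD hX
  · rw [abs_of_pos hy0]; linarith
  · simp [hy, hy0, hxy, tailCutoff_planePt]
  · filter_upwards [hdiff] with X hX hXU
    rw [gradient_stairFun_apply_zero S hD hX hXU.2.2.1]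
    have h1 := hXU.2.2.1
    have h2 := hXU.2.2.2.1
    exact div_pos (sub_pos.2 h2) (by linarith)

lemma integral_cross_jumpFun_ne_zero (S : Staircase D) (hD1 : D < 1) :
    ∫ X in Omg (n + 2), (gradient (jumpFun S.d) X 1 * (tailCutoff X *
      gradient (fun X : Euc (n + 2) => smoothStep (X 0)) X 0) -
      gradient (jumpFun S.d) X 0 * (tailCutoff X *
      gradient (fun X : Euc (n + 2) => smoothStep (X 0)) X 1)) ≠ 0 := by
  have hreg := regAway_jumpFun (n := n) S
  have hpos := ae_fracDist_pos (n := n) S hD1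
  have hdiff := hreg.ae_differentiableAt (continuous_fracDist S.continuous_d) hpos
  obtain ⟨y, hy0, hy1, hy⟩ := exists_deriv_smoothStep_pos
  obtain ⟨x, ⟨hx, hx0, hx1⟩, hdx⟩ := (Measure.dense_of_ae (S.ae_pos hD1)).inter_open_nonempty
    ({x | 0 < deriv smoothStep x} ∩ Set.Ioo 0 (1 / 8))
    ((isOpen_lt continuous_const continuous_deriv_smoothStep).inter isOpen_Ioo) ⟨y, hy, hy0, hy1⟩
  have hdx : 0 < S.d x := hdx
  have hx : 0 < deriv smoothStep x := hx
  have hO : IsOpen {X : Euc (n + 2) | 0 < deriv smoothStep (X 0) ∧ |X 1| < S.d (X 0) / 4 ∧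
      tailCutoff X ≠ 0} :=
    (isOpen_lt continuous_const (continuous_deriv_smoothStep.comp (continuous_apply_euc 0))).inter
      ((isOpen_lt (continuous_apply_euc 1).abs
        ((S.continuous_d.comp (continuous_apply_euc 0)).div_const 4)).inter
      (isOpen_ne_fun contDiff_tailCutoff.continuous continuous_const))
  refine integral_cross_smoothStep_ne_zero (by simp)
    (hreg.integrableOn_gradient hD1 zero_le_one le_rfl) ?_ (isOpen_omg.inter hO)
    ⟨planePt n x 0, planePt_mem ?_, ?_⟩ Set.inter_subset_left (fun X hX => hX.2.1)
    (fun X hX => hX.2.2.2) ?_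
  · filter_upwards [hdiff, hpos] with X hX hXp using gradient_jumpFun_nonneg S hXp hX
  · rw [abs_of_pos hx0, abs_zero]; linarith
  · simp [hx, hdx, tailCutoff_planePt]
  · filter_upwards [hdiff] with X hX hXU
    rw [gradient_jumpFun_apply_one S hX hXU.2.2.1]
    have h1 : |X 1| < S.d (X 0) / 4 := hXU.2.2.1
    exact div_pos two_pos (by linarith [abs_nonneg (X 1)])

end construction

/-- Theorem C (0-form case), W-minimizer ≠ H-minimizer for the Dirichlet problem
for the variable exponent integrand `Φ(x,t) = t^{p(x)}`. -/
theorem statement7 (N : ℕ) (hN : 2 ≤ N) (pm pp : ℝ) (hpm : 1 < pm) (hpmpp : pm < pp) :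
    ∃ (ϰ₀ : ℝ) (p : Euc N → ℝ) (ubd : Euc N → ℝ) (t₀ : ℝ),
      0 < ϰ₀ ∧
      -- the variable exponent
      Continuous p ∧ (∀ x, p x ∈ Set.Icc pm pp) ∧
      (∀ x y : Euc N, 0 < dist x y → dist x y ≤ Real.exp (-Real.exp 1) →
        |p x - p y| ≤ ϰ₀ * (Real.log (1 / dist x y))⁻¹ * Real.log (Real.log (1 / dist x y))) ∧
      -- the boundary datum
      ContDiff ℝ (⊤ : ℕ∞) ubd ∧ 0 < t₀ ∧
      ∀ t : ℝ, t₀ ≤ t →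
        ∃ (w : Euc N → ℝ) (g : Euc N → Euc N),
          HasWeakGradOn N w g ∧
          (∃ M : ℝ, ∀ x, |w x - t * ubd x| ≤ M) ∧
          HasCompactSupport (fun x => w x - t * ubd x) ∧
          tsupport (fun x => w x - t * ubd x) ⊆ Omg N ∧
          (∫⁻ x in Omg N, ENNReal.ofReal (‖g x‖ ^ p x)) < ⊤ ∧
          (∫⁻ x in Omg N, ENNReal.ofReal (‖g x‖ ^ p x)) <
            sInf { r : ℝ≥0∞ | ∃ φ : Euc N → ℝ, IsTestFun N φ ∧
              r = ∫⁻ x in Omg N, ENNReal.ofReal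
                    (‖t • gradient ubd x + gradient φ x‖ ^ p x) } := by
  obtain ⟨n, rfl⟩ : ∃ n, N = n + 2 := ⟨N - 2, by omega⟩
  obtain ⟨Kf, hKf, hKf'⟩ := exists_abs_smoothStep_sub_le
  have hfL : ∀ (i : Fin (n + 2)) (X Y : Euc (n + 2)),
      |smoothStep (X i) - smoothStep (Y i)| ≤ Kf * ‖X - Y‖ := fun i X Y =>
    (hKf' _ _).trans (mul_le_mul_of_nonneg_left (abs_apply_sub_le X Y i) hKf)
  rcases lt_or_ge pm 2 with h2 | h2
  · obtain ⟨p₀, hp₀, hlt⟩ := exists_between (lt_min hpmpp h2)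
    obtain ⟨hpp, hp₀2⟩ := lt_min_iff.1 hlt
    obtain ⟨D, rfl⟩ : ∃ D, p₀ = 2 - D := ⟨2 - p₀, by ring⟩
    have hD : 0 < D := by linarith
    have hD1 : D < 1 := by linarith
    obtain ⟨S⟩ := exists_staircase hD hD1
    exact exists_gap hpm hp₀ hpp (by omega) (by linarith) (continuous_fracDist S.continuous_d)
      fracDist_nonneg (fun _ => fracDist_le S)
      (fun _ => volume_fracDist_lt_le S.K_nonneg S.volume_le)
      one_pos le_rfl (one_mul _) (regAway_jumpFun S)
      (sub_pos.2 hD1) (by linarith)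
      (by rw [show 2 - D - 1 = 1 - D by ring]; exact mul_div_cancel₀ _ (sub_pos.2 hD1).ne')
      (regAway_stairFun S hD hD1.le) (by norm_num : (1 : ℝ) ≤ 4)
      (abs_sub_two_mul_tailExcess_sub_le (abs_sideFun_sub_le S))
      (contDiff_smoothStep_apply 1) (fun X => abs_smoothStep_le _) (hfL 1)
      contDiff_tailCutoff tailCutoff_nonneg tailCutoff_le_one
      (fderiv_tailCutoff_single tailProj_single_one) (fderiv_tailCutoff_single tailProj_single_zero)
      (integral_cross_stairFun_ne_zero S hD hD1)
      (fun X _ hX h => by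
        rw [tailExcess_eq_zero hX, mul_zero, sub_zero]
        exact le_sideFun_of_gradient_stairFun_ne S h)
      (fun X hX h => by
        linarith [sideFun_le_of_gradient_jumpFun_ne S hX h, tailExcess_nonneg X])
      (fun X => jumpFun_eventuallyEq_smoothStep S)
  · obtain ⟨p₀, hp₀, hpp⟩ := exists_between hpmpp
    have hp1 : 0 < p₀ - 1 := by linarith
    obtain ⟨D, hDp⟩ : ∃ D, p₀ / (p₀ - 1) = 2 - D := ⟨2 - p₀ / (p₀ - 1), by ring⟩
    have hD : 0 < D := by
      have : p₀ / (p₀ - 1) < 2 := (div_lt_iff₀ hp1).2 (by linarith)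
      linarith
    have hD1 : D < 1 := by
      have : 1 < p₀ / (p₀ - 1) := (one_lt_div hp1).2 (by linarith)
      linarith
    obtain ⟨S⟩ := exists_staircase hD hD1
    exact exists_gap hpm hp₀ hpp (by omega) (by linarith) (continuous_fracDist S.continuous_d)
      fracDist_nonneg (fun _ => fracDist_le S)
      (fun _ => volume_fracDist_lt_le S.K_nonneg S.volume_le)
      (sub_pos.2 hD1) (by linarith)
      (by
        rw [← hDp, show 1 - D = p₀ / (p₀ - 1) - 1 by linarith]
        field_simp
        ring)
      (regAway_stairFun S hD hD1.le)
      one_pos le_rfl (by rw [one_mul, hDp]) (regAway_jumpFun S) (by norm_num : (1 : ℝ) ≤ 4)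
      (abs_sub_two_mul_tailExcess_sub_le (h := fun X => -sideFun S.d X) fun X Y => by
        rw [neg_sub_neg, abs_sub_comm]; exact abs_sideFun_sub_le S X Y)
      (contDiff_smoothStep_apply 0) (fun X => abs_smoothStep_le _) (hfL 0)
      contDiff_tailCutoff tailCutoff_nonneg tailCutoff_le_one
      (fderiv_tailCutoff_single tailProj_single_zero) (fderiv_tailCutoff_single tailProj_single_one)
      (integral_cross_jumpFun_ne_zero S hD1)
      (fun X hδ hX h => by
        rw [tailExcess_eq_zero hX, mul_zero, sub_zero]
        linarith [sideFun_le_of_gradient_jumpFun_ne S hδ h])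
      (fun X _ h => by
        linarith [le_sideFun_of_gradient_stairFun_ne S h, tailExcess_nonneg X])
      (fun X => stairFun_eventuallyEq_smoothStep S)

end
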